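/- arXiv:1603.07171 — 4 statements merged into one kernel-verified Lean document; each statement's English description precedes it below -/
import Mathlib

section
/- Let F be a number field, n ≥ 2, N a positive multiple of n, and P(T) ∈ O_F[T] of degree N whose roots all have multiplicity at most n−1, with roots t_1,…,t_N and splitting field L. Assume the union of the subgroups Gal(L/F(t_j)), j = 1,…,N, is a proper subset of Gal(L/F). Then there exists d ∈ O_F \ {0}, not an n-th power in O_F, such that the twisted curve C_{d·P(T)} : Y^n = d·P(T,Z) has no F-rational points. -/
open NumberField Polynomial

namespace FrobDens
open Filter Topology Asymptotics IsDedekindDomain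

section Analytic
variable (K : Type*) [Field K] [NumberField K]

/-- the term `N(I)^{-s}` -/
noncomputable def nt (s : ℝ) (I : Ideal (𝓞 K)) : ℝ := (Ideal.absNorm I : ℝ) ^ (-s)

lemma nt_nonneg (s : ℝ) (I : Ideal (𝓞 K)) : 0 ≤ nt K s I := by unfold nt; positivity

lemma nt_mul (s : ℝ) (I J : Ideal (𝓞 K)) : nt K s (I * J) = nt K s I * nt K s J := by
  unfold nt
  rw [map_mul, Nat.cast_mul, Real.mul_rpow (by positivity) (by positivity)]

lemma nt_bot {s : ℝ} (hs : 1 < s) : nt K s ⊥ = 0 := by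
  unfold nt
  rw [Ideal.absNorm_bot, Nat.cast_zero, Real.zero_rpow (by linarith)]

lemma nt_one (s : ℝ) : nt K s 1 = 1 := by
  unfold nt; simp

noncomputable def cnt (n : ℕ) : ℂ := (Nat.card {I : Ideal (𝓞 K) // Ideal.absNorm I = n} : ℂ)

lemma lsum {s : ℝ} (hs : 1 < s) : LSeriesSummable (cnt K) s := by
  have h := tendsto_sub_one_mul_dedekindZeta_nhdsGT K
  have hne : ∀ᶠ t : ℝ in 𝓝[>] 1, ((t : ℂ) - 1) * dedekindZeta K t ≠ 0 := by
    refine h.eventually_ne ?_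
    exact_mod_cast dedekindZeta_residue_ne_zero K
  have hlt : ∀ᶠ t : ℝ in 𝓝[>] 1, t < s := 
    nhdsWithin_le_nhds (eventually_lt_nhds hs)
  obtain ⟨t, h1, h2⟩ := (hne.and hlt).exists
  have : LSeriesSummable (cnt K) t := by
    by_contra hcon
    apply h1
    have : dedekindZeta K t = 0 := tsum_eq_zero_of_not_summable hcon
    rw [this, mul_zero]
  exact this.of_re_le_re (by simpa using h2.le)

lemma fiber_finite (n : ℕ) : Finite {I : Ideal (𝓞 K) // Ideal.absNorm I = n} :=
  Ideal.finite_setOfPred_absNorm_eq n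

lemma term_eq {s : ℝ} (hs : 1 < s) (n : ℕ) :
    LSeries.term (cnt K) s n = 
      ((∑' I : {I : Ideal (𝓞 K) // Ideal.absNorm I = n}, nt K s I.1 : ℝ) : ℂ) := by
  have := fiber_finite K n
  have e : ∀ I : {I : Ideal (𝓞 K) // Ideal.absNorm I = n}, nt K s I.1 = (n:ℝ)^(-s) := by
    intro I; unfold nt; rw [I.2]
  simp_rw [e]
  rw [tsum_const]
  rcases eq_or_ne n 0 with rfl | hn
  · simp [Real.zero_rpow (show (-s) ≠ 0 by linarith)]
  · rw [LSeries.term_of_ne_zero hn, cnt, nsmul_eq_mul, Complex.ofReal_mul,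
      Complex.ofReal_cpow (by positivity)]
    push_cast
    rw [Complex.cpow_neg]
    rfl

lemma nt_hasSum {s : ℝ} (hs : 1 < s) :
    Summable (nt K s) ∧ ((∑' I, nt K s I : ℝ) : ℂ) = dedekindZeta K s := by
  have h1 : Summable (fun n : ℕ => ∑' I : {I : Ideal (𝓞 K) // Ideal.absNorm I = n}, nt K s I.1) := by
    have := lsum K hs
    unfold LSeriesSummable at this
    rw [show LSeries.term (cnt K) s = _ from funext (term_eq K hs)] at this
    exact_mod_cast this
  have h2 : Summable (fun x : Σ n : ℕ, {I : Ideal (𝓞 K) // Ideal.absNorm I = n} => nt K s x.2.1) := by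
    rw [summable_sigma_of_nonneg (fun x => nt_nonneg K s _)]
    refine ⟨fun n => ?_, h1⟩
    have := fiber_finite K n
    exact Summable.of_finite
  have h3 : Summable (nt K s) := 
    (Equiv.sigmaFiberEquiv (fun I : Ideal (𝓞 K) => Ideal.absNorm I)).summable_iff.mp h2
  refine ⟨h3, ?_⟩
  rw [← (Equiv.sigmaFiberEquiv (fun I : Ideal (𝓞 K) => Ideal.absNorm I)).tsum_eq]
  change ((∑' x : Σ n : ℕ, {I : Ideal (𝓞 K) // Ideal.absNorm I = n}, nt K s x.2.1 : ℝ) : ℂ) = _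
  rw [Summable.tsum_sigma (f := fun x : Σ n : ℕ, {I : Ideal (𝓞 K) // Ideal.absNorm I = n} => nt K s x.2.1) h2]
  rw [Complex.ofReal_tsum]
  unfold dedekindZeta LSeries
  refine tsum_congr fun n => ?_
  exact (term_eq K hs n).symm

noncomputable def Z (s : ℝ) : ℝ := ∑' I, nt K s I

lemma Z_tendsto : Tendsto (fun s : ℝ => (s - 1) * Z K s) (𝓝[>] 1) (𝓝 (dedekindZeta_residue K)) := by
  have h := tendsto_sub_one_mul_dedekindZeta_nhdsGT K
  have h2 : Tendsto (fun s : ℝ => (((s - 1) * Z K s : ℝ) : ℂ)) (𝓝[>] 1) (𝓝 ((dedekindZeta_residue K : ℝ) : ℂ)) := by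
    refine h.congr' ?_
    filter_upwards [self_mem_nhdsWithin] with s hs
    rw [← (nt_hasSum K hs).2, Z, Complex.ofReal_mul, Complex.ofReal_sub, Complex.ofReal_one]
  exact tendsto_ofReal_iff.mp h2

/-- ideals divisible by no prime in `S` -/
def cop (S : Finset (HeightOneSpectrum (𝓞 K))) : Set (Ideal (𝓞 K)) := {I | ∀ v ∈ S, ¬ v.asIdeal ∣ I}

lemma cop_step {s : ℝ} (hs : 1 < s) (S : Finset (HeightOneSpectrum (𝓞 K))) [DecidableEq (HeightOneSpectrum (𝓞 K))]
    (v : HeightOneSpectrum (𝓞 K))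
    (hv : v ∉ S) : ∑' I, (cop K (insert v S)).indicator (nt K s) I = 
      (1 - nt K s v.asIdeal) * ∑' I, (cop K S).indicator (nt K s) I := by
  have hsm := (nt_hasSum K hs).1
  have h1 := hsm.indicator (cop K S)
  set g := (cop K S).indicator (nt K s) with hg
  have hinj : Function.Injective (fun I : Ideal (𝓞 K) => v.asIdeal * I) := 
    mul_right_injective₀ v.ne_bot
  have key : ∑' I, (Set.range (fun I : Ideal (𝓞 K) => v.asIdeal * I)).indicator g I = 
     nt K s v.asIdeal * ∑' I, g I := by
    rw [← tsum_subtype, tsum_range (g := fun I : Ideal (𝓞 K) => v.asIdeal * I) g hinj, ← tsum_mul_left]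
    refine tsum_congr fun I => ?_
    have : (v.asIdeal * I ∈ cop K S) ↔ I ∈ cop K S := by
      unfold cop
      simp only [Set.mem_ofPred_eq]
      refine forall₂_congr fun w hw => not_congr ?_
      rw [w.prime.dvd_mul]
      refine ⟨fun h => h.resolve_left fun h => ?_, Or.inr⟩
      apply hv
      have := (Ideal.IsPrime.isMaximal v.isPrime v.ne_bot).eq_of_le (Ideal.IsPrime.isMaximal w.isPrime w.ne_bot).ne_top (Ideal.le_of_dvd h)
      rwa [HeightOneSpectrum.ext this]
    by_cases hI : I ∈ cop K S
    · rw [hg, Set.indicator_of_mem (this.2 hI), Set.indicator_of_mem hI, nt_mul]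
    · rw [hg, Set.indicator_of_notMem (fun h => hI (this.1 h)), Set.indicator_of_notMem hI, mul_zero]
  rw [sub_mul, one_mul, ← key, ← Summable.tsum_sub h1 (h1.indicator _)]
  refine tsum_congr fun I => ?_
  by_cases hI : v.asIdeal ∣ I
  · have : I ∈ Set.range (fun I : Ideal (𝓞 K) => v.asIdeal * I) := by
      obtain ⟨J, rfl⟩ := hI; exact ⟨J, rfl⟩
    rw [Set.indicator_of_mem this, sub_self, Set.indicator_of_notMem]
    intro h
    exact h v (Finset.mem_insert_self _ _) hI
  · have : I ∉ Set.range (fun I : Ideal (𝓞 K) => v.asIdeal * I) := by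
      rintro ⟨J, rfl⟩; exact hI ⟨J, rfl⟩
    rw [Set.indicator_of_notMem this, sub_zero]
    have : I ∈ cop K (insert v S) ↔ I ∈ cop K S := by
      unfold cop
      simp [hI]
    by_cases hI : I ∈ cop K S
    · rw [hg, Set.indicator_of_mem (this.2 hI), Set.indicator_of_mem hI]
    · rw [hg, Set.indicator_of_notMem (fun h => hI (this.1 h)), Set.indicator_of_notMem hI]

lemma cop_prod {s : ℝ} (hs : 1 < s) (S : Finset (HeightOneSpectrum (𝓞 K))) :
    ∑' I, (cop K S).indicator (nt K s) I = (∏ v ∈ S, (1 - nt K s v.asIdeal)) * Z K s := by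
  classical
  induction S using Finset.induction_on with
  | empty => simp [cop, Z]
  | insert v S hv ih => rw [cop_step K hs S v hv, ih, Finset.prod_insert hv, mul_assoc]

lemma cop_tendsto {s : ℝ} (hs : 1 < s) : 
    Tendsto (fun S => ∑' I, (cop K S).indicator (nt K s) I) atTop (𝓝 1) := by
  classical
  have : (1 : ℝ) = ∑' I, ({1} : Set (Ideal (𝓞 K))).indicator (nt K s) I := by
    rw [← tsum_subtype, tsum_singleton 1, nt_one]
  rw [this]
  refine tendsto_tsum_of_dominated_convergence (bound := nt K s) (nt_hasSum K hs).1 ?_ ?_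
  · intro I
    refine tendsto_const_nhds.congr' ?_
    by_cases h1 : I = 1
    · refine Eventually.of_forall fun S => ?_
      beta_reduce
      rw [Set.indicator_of_mem (by simpa using h1), Set.indicator_of_mem]
      intro v hv hd
      rw [h1] at hd
      exact v.prime.not_isUnit (isUnit_of_dvd_one hd)
    · rcases eq_or_ne I ⊥ with rfl | h0
      · refine Eventually.of_forall fun S => ?_
        simp [Set.indicator_apply, nt_bot K hs]
      have h1' : I ≠ ⊤ := by simpa [Ideal.one_eq_top] using h1
      obtain ⟨M, hM, hle⟩ := Ideal.exists_le_maximal I h1'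
      have hMb : M ≠ ⊥ := fun h => h0 (by rw [h] at hle; exact le_bot_iff.mp hle)
      filter_upwards [eventually_ge_atTop {(⟨M, hM.isPrime, hMb⟩ : HeightOneSpectrum (𝓞 K))}] with S hS
      rw [Set.indicator_of_notMem (by simpa using h1), Set.indicator_of_notMem]
      intro h
      exact h _ (hS (Finset.mem_singleton_self _)) (Ideal.dvd_iff_le.2 hle)
  · refine Eventually.of_forall fun S I => ?_
    rw [Real.norm_of_nonneg (Set.indicator_nonneg (fun _ _ => nt_nonneg K s _) _)]
    exact Set.indicator_le_self' (fun _ _ => nt_nonneg K s _) _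

lemma Z_pos {s : ℝ} (hs : 1 < s) : 0 < Z K s :=
  (nt_hasSum K hs).1.tsum_pos (nt_nonneg K s) 1 (by rw [nt_one]; norm_num)

lemma two_le (v : HeightOneSpectrum (𝓞 K)) : 2 ≤ Ideal.absNorm v.asIdeal := by
  have h0 : Ideal.absNorm v.asIdeal ≠ 0 := by
    rw [Ne, Ideal.absNorm_eq_zero_iff]; exact v.ne_bot
  have h1 : Ideal.absNorm v.asIdeal ≠ 1 := by
    rw [Ne, Ideal.absNorm_eq_one_iff]; exact v.isPrime.ne_top
  omega

lemma nt_le_half {s : ℝ} (hs : 1 < s) (v : HeightOneSpectrum (𝓞 K)) : nt K s v.asIdeal ≤ 1 / 2 := by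
  unfold nt
  have h2 : (2 : ℝ) ≤ Ideal.absNorm v.asIdeal := by exact_mod_cast two_le K v
  calc (Ideal.absNorm v.asIdeal : ℝ) ^ (-s) ≤ (Ideal.absNorm v.asIdeal : ℝ) ^ (-1 : ℝ) :=
        Real.rpow_le_rpow_of_exponent_le (by linarith) (by linarith)
    _ ≤ 1 / 2 := by
        rw [Real.rpow_neg_one, ← one_div]
        exact one_div_le_one_div_of_le (by norm_num) h2

lemma prime_summable {s : ℝ} (hs : 1 < s) : Summable (fun v : HeightOneSpectrum (𝓞 K) => nt K s v.asIdeal) :=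
  (nt_hasSum K hs).1.comp_injective (i := fun v : HeightOneSpectrum (𝓞 K) => v.asIdeal) 
    (fun _ _ h => HeightOneSpectrum.ext h)

lemma log_hasSum {s : ℝ} (hs : 1 < s) : 
    HasSum (fun v : HeightOneSpectrum (𝓞 K) => - Real.log (1 - nt K s v.asIdeal)) (Real.log (Z K s)) := by
  have h := cop_tendsto K hs
  have h2 := (h.log one_ne_zero).const_sub (Real.log (Z K s))
  rw [Real.log_one, sub_zero] at h2
  refine h2.congr fun S => ?_
  rw [cop_prod K hs S, Real.log_mul, Real.log_prod]
  · simp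
  · intro v hv
    have := nt_le_half K hs v
    linarith
  · refine Finset.prod_ne_zero_iff.2 fun v hv => ?_
    have := nt_le_half K hs v
    linarith
  · exact (Z_pos K hs).ne'

/-- sum over primes -/
noncomputable def SP (s : ℝ) : ℝ := ∑' v : HeightOneSpectrum (𝓞 K), nt K s v.asIdeal

lemma log_est {x : ℝ} (h0 : 0 ≤ x) (h1 : x ≤ 1 / 2) : |(- Real.log (1 - x)) - x| ≤ 2 * x ^ 2 := by
  have h := Real.abs_log_sub_add_sum_range_le (x := x) (by rw [abs_of_nonneg h0]; linarith) 1
  simp at h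
  rw [abs_of_nonneg h0] at h
  rw [show - Real.log (1 - x) - x = -(x + Real.log (1 - x)) by ring, abs_neg]
  refine h.trans ?_
  rw [div_le_iff₀ (by linarith)]
  nlinarith [sq_nonneg x]

lemma SP_log_Z {s : ℝ} (hs : 1 < s) : |Real.log (Z K s) - SP K s| ≤ 2 * SP K 2 := by
  have h1 := log_hasSum K hs
  have h2 := (prime_summable K hs).hasSum
  have h3 := h1.sub h2
  have hb := (prime_summable K (s := 2) (by norm_num)).hasSum.mul_left 2
  refine h3.norm_le_of_bounded hb fun v => ?_
  refine (log_est (nt_nonneg K s _) (nt_le_half K hs v)).trans ?_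
  have h2 : (2 : ℝ) ≤ Ideal.absNorm v.asIdeal := by exact_mod_cast two_le K v
  gcongr
  unfold nt
  rw [← Real.rpow_natCast, ← Real.rpow_mul (by linarith)]
  apply Real.rpow_le_rpow_of_exponent_le (by linarith)
  push_cast
  linarith

noncomputable def ell (s : ℝ) : ℝ := - Real.log (s - 1)

lemma SP_isBigO : (fun s => SP K s - ell s) =O[𝓝[>] 1] (fun _ => (1 : ℝ)) := by
  have h1 : (fun s => SP K s - Real.log (Z K s)) =O[𝓝[>] 1] (fun _ => (1 : ℝ)) := by
    refine IsBigO.of_bound (2 * SP K 2) ?_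
    filter_upwards [self_mem_nhdsWithin] with s hs
    rw [norm_one, mul_one, ← norm_neg, neg_sub]
    exact SP_log_Z K hs
  have h2 : (fun s => Real.log (Z K s) - ell s) =O[𝓝[>] 1] (fun _ => (1 : ℝ)) := by
    have := (Z_tendsto K).log (dedekindZeta_residue_ne_zero K)
    refine (this.isBigO_one ℝ).congr' ?_ EventuallyEq.rfl
    filter_upwards [self_mem_nhdsWithin] with s hs
    have hs' : (0:ℝ) < s - 1 := sub_pos.2 hs
    rw [Real.log_mul hs'.ne' (Z_pos K hs).ne', ell]
    ring
  simpa using h1.add h2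

end Analytic
section Algebraic
set_option linter.unusedSectionVars false
variable {F K L : Type*} [Field F] [NumberField F] [Field K] [NumberField K] [Field L] [NumberField L]
  [Algebra F K] [Algebra F L] [Algebra K L] [IsScalarTower F K L] [IsGalois F L]

variable (K) in
/-- contraction of a twist of `P` -/
noncomputable def Qi (P : Ideal (𝓞 L)) (g : L ≃ₐ[F] L) : Ideal (𝓞 K) :=
  Ideal.comap ((MulSemiringAction.toRingHom (L ≃ₐ[F] L) (𝓞 L) g).comp (algebraMap (𝓞 K) (𝓞 L))) P

lemma mem_Qi {P : Ideal (𝓞 L)} {g : L ≃ₐ[F] L} {x : 𝓞 K} :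
    x ∈ Qi K P g ↔ g • algebraMap (𝓞 K) (𝓞 L) x ∈ P := Iff.rfl

lemma smul_alg (g : L ≃ₐ[F] L) (a : 𝓞 F) :
    g • algebraMap (𝓞 K) (𝓞 L) (algebraMap (𝓞 F) (𝓞 K) a) = algebraMap (𝓞 F) (𝓞 L) a := by
  rw [← IsScalarTower.algebraMap_apply, smul_algebraMap]

lemma under_Qi (P : Ideal (𝓞 L)) (g : L ≃ₐ[F] L) : (Qi K P g).under (𝓞 F) = P.under (𝓞 F) := by
  ext a
  rw [Ideal.under, Ideal.mem_comap, mem_Qi, smul_alg]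
  rfl

variable {v : HeightOneSpectrum (𝓞 F)} {P : Ideal (𝓞 L)} [hP : P.IsPrime]

variable (K) in
noncomputable def QH (hv : P.under (𝓞 F) = v.asIdeal) (g : L ≃ₐ[F] L) : HeightOneSpectrum (𝓞 K) :=
  ⟨Qi K P g, Ideal.comap_isPrime _ _, fun h => by
    have := under_Qi (K := K) P g
    rw [hv, h] at this
    apply v.ne_bot
    rw [← this]
    exact Ideal.under_bot _ _⟩

lemma QH_under (hv : P.under (𝓞 F) = v.asIdeal) (g : L ≃ₐ[F] L) : (QH K hv g).under (𝓞 F) = v :=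
  HeightOneSpectrum.ext ((under_Qi P g).trans hv)

lemma QH_surj (hv : P.under (𝓞 F) = v.asIdeal) (w : HeightOneSpectrum (𝓞 K)) (hw : w.under (𝓞 F) = v) :
    ∃ g, QH K hv g = w := by
  have := w.isPrime
  obtain ⟨P', -, hP', h⟩ := Ideal.exists_ideal_over_prime_of_isIntegral (S := 𝓞 L) w.asIdeal ⊥ (by
    change Ideal.under _ _ ≤ _
    rw [Ideal.under_bot]; exact bot_le)
  have h2 : P.under (𝓞 F) = P'.under (𝓞 F) := by
    rw [hv, ← hw, ← Ideal.under_under (B := 𝓞 K) P']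
    change w.asIdeal.under (𝓞 F) = (Ideal.comap (algebraMap (𝓞 K) (𝓞 L)) P').under (𝓞 F)
    rw [h]
  obtain ⟨g, hg⟩ := Algebra.IsInvariant.exists_smul_of_under_eq (𝓞 F) (𝓞 L) (L ≃ₐ[F] L) P P' h2
  refine ⟨g⁻¹, HeightOneSpectrum.ext ?_⟩
  ext x
  change x ∈ Qi K P g⁻¹ ↔ _
  rw [mem_Qi, ← h, hg, Ideal.pointwise_smul_eq_comap, Ideal.mem_comap, Ideal.mem_comap]
  rfl

lemma norm_alt (w : HeightOneSpectrum (𝓞 K)) (hw : w.under (𝓞 F) = v) :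
    Ideal.absNorm v.asIdeal ≤ Ideal.absNorm w.asIdeal ∧ 
    (Ideal.absNorm w.asIdeal ≠ Ideal.absNorm v.asIdeal → 
      Ideal.absNorm v.asIdeal ^ 2 ≤ Ideal.absNorm w.asIdeal) := by
  have : w.asIdeal.LiesOver v.asIdeal := ⟨by rw [← hw]; rfl⟩
  have h := Ideal.absNorm_eq_pow_inertiaDeg'_of_liesOver w.asIdeal v.asIdeal v.isPrime v.ne_bot
  have h1 : Ideal.absNorm w.asIdeal ≠ 1 := by
    rw [Ne, Ideal.absNorm_eq_one_iff]; exact w.isPrime.ne_top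
  have h0 : Ideal.absNorm v.asIdeal ≠ 0 := by
    rw [Ne, Ideal.absNorm_eq_zero_iff]; exact v.ne_bot
  rw [h] at h1 ⊢
  generalize Ideal.inertiaDeg' v.asIdeal w.asIdeal = f at *
  have hf : f ≠ 0 := by rintro rfl; simp at h1
  refine ⟨Nat.le_self_pow hf _, fun h2 => Nat.pow_le_pow_right (Nat.pos_of_ne_zero h0) ?_⟩
  have : f ≠ 1 := by rintro rfl; simp at h2
  omega

lemma card_quot (v : HeightOneSpectrum (𝓞 F)) : Nat.card (𝓞 F ⧸ v.asIdeal) = Ideal.absNorm v.asIdeal := by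
  rw [Ideal.absNorm_apply]; rfl

lemma norm_iff (w : HeightOneSpectrum (𝓞 K)) (hw : w.under (𝓞 F) = v) :
    Ideal.absNorm w.asIdeal = Ideal.absNorm v.asIdeal ↔ 
      ∀ x : 𝓞 K, x ^ (Ideal.absNorm v.asIdeal) - x ∈ w.asIdeal := by
  have hfin : Finite (𝓞 K ⧸ w.asIdeal) := Ideal.finiteQuotientOfFreeOfNeBot _ w.ne_bot
  have hmax : w.asIdeal.IsMaximal := w.isMaximal
  let _ : Field (𝓞 K ⧸ w.asIdeal) := Ideal.Quotient.field w.asIdeal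
  let _ : Fintype (𝓞 K ⧸ w.asIdeal) := Fintype.ofFinite _
  constructor
  · intro h x
    rw [← Ideal.Quotient.eq, map_pow, ← h, ← card_quot, Nat.card_eq_fintype_card, FiniteField.pow_card]
  · intro h
    refine le_antisymm ?_ (norm_alt w hw).1
    set q := Ideal.absNorm v.asIdeal
    have hq : 1 < q := by
      have h1 : Ideal.absNorm v.asIdeal ≠ 1 := by
        rw [Ne, Ideal.absNorm_eq_one_iff]; exact v.isPrime.ne_top
      have h0 : Ideal.absNorm v.asIdeal ≠ 0 := by
        rw [Ne, Ideal.absNorm_eq_zero_iff]; exact v.ne_bot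
      omega
    have hne : (X ^ q - X : (𝓞 K ⧸ w.asIdeal)[X]) ≠ 0 := FiniteField.X_pow_card_sub_X_ne_zero _ hq
    have hle : Fintype.card (𝓞 K ⧸ w.asIdeal) ≤ (X ^ q - X : (𝓞 K ⧸ w.asIdeal)[X]).natDegree := by
      rw [← Finset.card_univ]
      apply Polynomial.card_le_degree_of_subset_roots
      intro y _
      rw [Polynomial.mem_roots hne]
      obtain ⟨x, rfl⟩ := Ideal.Quotient.mk_surjective y
      have := h x
      rw [← Ideal.Quotient.eq, map_pow] at this
      simp [Polynomial.IsRoot, this]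
    rw [FiniteField.X_pow_card_sub_X_natDegree_eq _ hq] at hle
    rwa [← card_quot, Nat.card_eq_fintype_card]

lemma exists_rep (w : HeightOneSpectrum (𝓞 K)) (hw : w.under (𝓞 F) = v)
    (h : Ideal.absNorm w.asIdeal = Ideal.absNorm v.asIdeal) (x : 𝓞 K) : 
    ∃ a : 𝓞 F, x - algebraMap _ _ a ∈ w.asIdeal := by
  have hfin : Finite (𝓞 K ⧸ w.asIdeal) := Ideal.finiteQuotientOfFreeOfNeBot _ w.ne_bot
  have hfin : Finite (𝓞 F ⧸ v.asIdeal) := Ideal.finiteQuotientOfFreeOfNeBot _ v.ne_bot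
  have : w.asIdeal.LiesOver v.asIdeal := ⟨by rw [← hw]; rfl⟩
  have hinj : Function.Injective (algebraMap (𝓞 F ⧸ v.asIdeal) (𝓞 K ⧸ w.asIdeal)) := 
    FaithfulSMul.algebraMap_injective _ _
  have hbij := (Nat.bijective_iff_injective_and_card _).2 ⟨hinj, by rw [card_quot, card_quot, h]⟩
  obtain ⟨y, hy⟩ := hbij.2 (Ideal.Quotient.mk _ x)
  obtain ⟨a, rfl⟩ := Ideal.Quotient.mk_surjective y
  refine ⟨a, ?_⟩
  rw [← Ideal.Quotient.eq, ← hy]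
  rfl

/-- Galois hypothesis linking the field `K` and the group `H`, at `P` -/
def Good (K : Type*) [Field K] [Algebra K L] (P : Ideal (𝓞 L)) (H : Subgroup (L ≃ₐ[F] L)) : Prop :=
  ∀ g τ : L ≃ₐ[F] L, τ ∉ H → ∃ x : 𝓞 K, 
    (g * τ) • algebraMap (𝓞 K) (𝓞 L) x - g • algebraMap (𝓞 K) (𝓞 L) x ∉ P

lemma norm_QH_iff (hv : P.under (𝓞 F) = v.asIdeal) {φ : L ≃ₐ[F] L} (hφ : IsArithFrobAt (𝓞 F) φ P)
    (H : Subgroup (L ≃ₐ[F] L)) (hH : ∀ τ ∈ H, ∀ x : 𝓞 K, τ • algebraMap (𝓞 K) (𝓞 L) x = algebraMap (𝓞 K) (𝓞 L) x)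
    (hg : Good K P H) (g : L ≃ₐ[F] L) : 
    Ideal.absNorm (QH K hv g).asIdeal = Ideal.absNorm v.asIdeal ↔ g⁻¹ * φ * g ∈ H := by
  have hφ' : ∀ x : 𝓞 L, φ • x - x ^ (Ideal.absNorm v.asIdeal) ∈ P := by
    intro x
    have := hφ x
    rw [hv, card_quot] at this
    exact this
  rw [norm_iff _ (QH_under hv g)]
  have key : ∀ x : 𝓞 K, (x ^ (Ideal.absNorm v.asIdeal) - x ∈ (QH K hv g).asIdeal ↔ 
      (g * (g⁻¹ * φ * g)) • algebraMap (𝓞 K) (𝓞 L) x - g • algebraMap (𝓞 K) (𝓞 L) x ∈ P) := by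
    intro x
    change _ ∈ Qi K P g ↔ _
    rw [mem_Qi, map_sub, map_pow, smul_sub, smul_pow', ← mul_assoc, mul_inv_cancel_left, mul_smul]
    have := hφ' (g • algebraMap (𝓞 K) (𝓞 L) x)
    constructor
    · intro h
      simpa using P.add_mem this h
    · intro h
      simpa using P.sub_mem h this
  simp_rw [key]
  constructor
  · intro h
    by_contra hcon
    obtain ⟨x, hx⟩ := hg g _ hcon
    exact hx (h x)
  · intro h x
    rw [mul_smul g, hH _ h, sub_self]
    exact P.zero_mem

lemma QH_eq_iff (hv : P.under (𝓞 F) = v.asIdeal) 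
    (H : Subgroup (L ≃ₐ[F] L)) (hH : ∀ τ ∈ H, ∀ x : 𝓞 K, τ • algebraMap (𝓞 K) (𝓞 L) x = algebraMap (𝓞 K) (𝓞 L) x)
    (hg : Good K P H) (g g' : L ≃ₐ[F] L) 
    (hn : Ideal.absNorm (QH K hv g).asIdeal = Ideal.absNorm v.asIdeal) :
    QH K hv g' = QH K hv g ↔ g⁻¹ * g' ∈ H := by
  constructor
  · intro h
    by_contra hcon
    obtain ⟨x, hx⟩ := hg g _ hcon
    apply hx
    obtain ⟨a, ha⟩ := exists_rep _ (QH_under hv g) hn x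
    have ha' := ha
    rw [← h] at ha'
    change _ ∈ Qi K P g at ha
    change _ ∈ Qi K P g' at ha'
    rw [mem_Qi, map_sub, smul_sub, smul_alg] at ha ha'
    rw [mul_inv_cancel_left]
    have := P.sub_mem ha' ha
    rwa [sub_sub_sub_cancel_right] at this
  · intro h
    apply HeightOneSpectrum.ext
    ext x
    change x ∈ Qi K P g' ↔ x ∈ Qi K P g
    rw [mem_Qi, mem_Qi, show g' = g * (g⁻¹ * g') by group, mul_smul, hH _ h]

lemma count (hv : P.under (𝓞 F) = v.asIdeal) {φ : L ≃ₐ[F] L} (hφ : IsArithFrobAt (𝓞 F) φ P)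
    (H : Subgroup (L ≃ₐ[F] L)) (hH : ∀ τ ∈ H, ∀ x : 𝓞 K, τ • algebraMap (𝓞 K) (𝓞 L) x = algebraMap (𝓞 K) (𝓞 L) x)
    (hg : Good K P H) : 
    Nat.card {g : L ≃ₐ[F] L // g⁻¹ * φ * g ∈ H} = Nat.card H * 
      Nat.card {w : HeightOneSpectrum (𝓞 K) // w.under (𝓞 F) = v ∧ Ideal.absNorm w.asIdeal = Ideal.absNorm v.asIdeal} := by
  rw [mul_comm, ← Nat.card_prod]
  have hs : ∀ w : {w : HeightOneSpectrum (𝓞 K) // w.under (𝓞 F) = v ∧ Ideal.absNorm w.asIdeal = Ideal.absNorm v.asIdeal},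
    ∃ g, QH K hv g = w.1 := fun w => QH_surj hv w.1 w.2.1
  choose r hr using hs
  symm
  refine Nat.card_congr (Equiv.ofBijective (fun x => ⟨r x.1 * x.2.1, ?_⟩) ⟨?_, ?_⟩)
  · rw [← norm_QH_iff (K := K) hv hφ H hH hg, (QH_eq_iff hv H hH hg (r x.1) _ ?_).2, hr]
    · exact x.1.2.2
    · rw [inv_mul_cancel_left]; exact x.2.2
    · rw [hr]; exact x.1.2.2
  · rintro ⟨w, h⟩ ⟨w', h'⟩ he
    have he : r w * h.1 = r w' * h'.1 := congrArg Subtype.val he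
    have hw : ∀ w (h : H), QH K hv (r w * h.1) = w.1 := by
      intro w h
      rw [(QH_eq_iff hv H hH hg (r w) _ ?_).2, hr]
      · rw [inv_mul_cancel_left]; exact h.2
      · rw [hr]; exact w.2.2
    have : w = w' := by
      apply Subtype.ext
      rw [← hw w h, he, hw]
    subst this
    rw [Prod.mk.injEq]
    exact ⟨rfl, Subtype.ext (mul_left_cancel he)⟩
  · rintro ⟨g, hgm⟩
    have hn := (norm_QH_iff (K := K) hv hφ H hH hg g).2 hgm
    let w : {w : HeightOneSpectrum (𝓞 K) // w.under (𝓞 F) = v ∧ Ideal.absNorm w.asIdeal = Ideal.absNorm v.asIdeal} :=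
      ⟨QH K hv g, QH_under hv g, hn⟩
    have h2 : (r w)⁻¹ * g ∈ H := by
      rw [← QH_eq_iff (K := K) hv H hH hg, hr]
      rw [hr]; exact hn
    refine ⟨⟨w, ⟨_, h2⟩⟩, Subtype.ext ?_⟩
    simp

lemma fiber_fin (v : HeightOneSpectrum (𝓞 F)) (hv : P.under (𝓞 F) = v.asIdeal) : 
    Finite {w : HeightOneSpectrum (𝓞 K) // w.under (𝓞 F) = v} ∧ 
    Nat.card {w : HeightOneSpectrum (𝓞 K) // w.under (𝓞 F) = v} ≤ Nat.card (L ≃ₐ[F] L) := by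
  have : Function.Surjective (fun g => (⟨QH K hv g, QH_under hv g⟩ : {w : HeightOneSpectrum (𝓞 K) // w.under (𝓞 F) = v})) := by
    rintro ⟨w, hw⟩
    obtain ⟨g, hg⟩ := QH_surj hv w hw
    exact ⟨g, Subtype.ext hg⟩
  exact ⟨Finite.of_surjective _ this, Nat.card_le_card_of_surjective _ this⟩

end Algebraic


section Combine
set_option linter.unusedSectionVars false
variable {F L : Type*} [Field F] [NumberField F] [Field L] [NumberField L]
  [Algebra F L] [IsGalois F L]

lemma exists_frob (v : HeightOneSpectrum (𝓞 F)) : ∃ (P : Ideal (𝓞 L)) (φ : L ≃ₐ[F] L),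
    P.IsPrime ∧ P.under (𝓞 F) = v.asIdeal ∧ IsArithFrobAt (𝓞 F) φ P := by
  have := v.isPrime
  obtain ⟨P, -, hP, h⟩ := Ideal.exists_ideal_over_prime_of_isIntegral (S := 𝓞 L) v.asIdeal ⊥ (by
    change Ideal.under _ _ ≤ _
    rw [Ideal.under_bot]; exact bot_le)
  have hb : P ≠ ⊥ := by
    rintro rfl
    apply v.ne_bot
    rw [← h]
    exact Ideal.under_bot _ _
  have : Finite (𝓞 L ⧸ P) := Ideal.finiteQuotientOfFreeOfNeBot _ hb
  obtain ⟨φ, hφ⟩ := IsArithFrobAt.exists_of_isInvariant (𝓞 F) (L ≃ₐ[F] L) P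
  exact ⟨P, φ, hP, h, hφ⟩

lemma fin_bad {PP : HeightOneSpectrum (𝓞 F) → Ideal (𝓞 L)} 
    (hu : ∀ v, (PP v).under (𝓞 F) = v.asIdeal) (y : 𝓞 L) (hy : y ≠ 0) : {v | y ∈ PP v}.Finite := by
  have h : (Ideal.span {y}).under (𝓞 F) ≠ ⊥ := Ideal.under_ne_bot _ (by simpa using hy)
  refine (Ideal.finite_factors h).subset fun v hv => ?_
  have hv : y ∈ PP v := hv
  refine Ideal.dvd_iff_le.2 ?_
  rw [← hu v]
  exact Ideal.comap_mono ((Ideal.span_singleton_le_iff_mem _).2 hv)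

lemma good_finite {K : Type*} [Field K] [NumberField K] [Algebra K L]
    {PP : HeightOneSpectrum (𝓞 F) → Ideal (𝓞 L)} 
    (hu : ∀ v, (PP v).under (𝓞 F) = v.asIdeal) (H : Subgroup (L ≃ₐ[F] L))
    (hH : ∀ τ ∉ H, ∃ x : 𝓞 K, τ • algebraMap (𝓞 K) (𝓞 L) x ≠ algebraMap (𝓞 K) (𝓞 L) x) :
    {v | ¬ Good K (PP v) H}.Finite := by
  choose! x hx using hH
  have : {v | ¬ Good K (PP v) H} ⊆ ⋃ g : L ≃ₐ[F] L, ⋃ τ : (Hᶜ : Set (L ≃ₐ[F] L)), 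
    {v | (g * τ.1) • algebraMap (𝓞 K) (𝓞 L) (x τ.1) - g • algebraMap (𝓞 K) (𝓞 L) (x τ.1) ∈ PP v} := by
    intro v hv
    have hv : ¬ Good K (PP v) H := hv
    unfold Good at hv
    push Not at hv
    obtain ⟨g, τ, hτ, h⟩ := hv
    exact Set.mem_iUnion.2 ⟨g, Set.mem_iUnion.2 ⟨⟨τ, hτ⟩, h (x τ)⟩⟩
  refine Set.Finite.subset (Set.finite_iUnion fun g => Set.finite_iUnion fun τ => fin_bad hu _ ?_) this
  rw [mul_smul, ← smul_sub, Ne, smul_eq_zero_iff_eq, sub_eq_zero]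
  exact hx τ.1 τ.2

lemma SP_fiber (K : Type*) [Field K] [NumberField K] [Algebra F K] {s : ℝ} (hs : 1 < s) :
    HasSum (fun v : HeightOneSpectrum (𝓞 F) => 
      ∑' w : {w : HeightOneSpectrum (𝓞 K) // w.under (𝓞 F) = v}, nt K s w.1.asIdeal) (SP K s) := by
  have h := (prime_summable K hs)
  have h2 := (Equiv.sigmaFiberEquiv (fun w : HeightOneSpectrum (𝓞 K) => w.under (𝓞 F))).hasSum_iff.2 h.hasSum
  exact h2.sigma fun v => (h2.summable.sigma_factor v).hasSum

lemma nt_le_one {s : ℝ} (hs : 1 < s) (v : HeightOneSpectrum (𝓞 F)) : nt F s v.asIdeal ≤ 1 :=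
  (nt_le_half F hs v).trans (by norm_num)

lemma local_bound {K : Type*} [Field K] [NumberField K] [Algebra F K] 
    {s : ℝ} (hs : 1 < s) (v : HeightOneSpectrum (𝓞 F)) (M : ℕ)
    (hfin : Finite {w : HeightOneSpectrum (𝓞 K) // w.under (𝓞 F) = v})
    (hM : Nat.card {w : HeightOneSpectrum (𝓞 K) // w.under (𝓞 F) = v} ≤ M) : 
    |(Nat.card {w : HeightOneSpectrum (𝓞 K) // w.under (𝓞 F) = v ∧ Ideal.absNorm w.asIdeal = Ideal.absNorm v.asIdeal} : ℝ) 
      * nt F s v.asIdeal - ∑' w : {w : HeightOneSpectrum (𝓞 K) // w.under (𝓞 F) = v}, nt K s w.1.asIdeal| 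
      ≤ M * nt F 2 v.asIdeal := by
  classical
  let _ := Fintype.ofFinite {w : HeightOneSpectrum (𝓞 K) // w.under (𝓞 F) = v}
  rw [← Nat.card_congr (Equiv.subtypeSubtypeEquivSubtypeInter (fun w : HeightOneSpectrum (𝓞 K) => w.under (𝓞 F) = v)
    (fun w => Ideal.absNorm w.asIdeal = Ideal.absNorm v.asIdeal)), Nat.card_eq_fintype_card, Fintype.card_subtype, 
    tsum_fintype, ← nsmul_eq_mul, ← Finset.sum_const, Finset.sum_filter, ← Finset.sum_sub_distrib]
  refine (Finset.abs_sum_le_sum_abs _ _).trans ?_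
  have h : ∀ w : {w : HeightOneSpectrum (𝓞 K) // w.under (𝓞 F) = v}, 
     |(if Ideal.absNorm w.1.asIdeal = Ideal.absNorm v.asIdeal then nt F s v.asIdeal else 0) - nt K s w.1.asIdeal| ≤ nt F 2 v.asIdeal := by
    intro w
    split_ifs with h
    · rw [show nt K s w.1.asIdeal = nt F s v.asIdeal by unfold nt; rw [h], sub_self, abs_zero]
      exact nt_nonneg F 2 _
    · rw [zero_sub, abs_neg, abs_of_nonneg (nt_nonneg K s _)]
      have h2 := (norm_alt w.1 w.2).2 h
      have h3 := two_le F v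
      unfold nt
      have h2' : (Ideal.absNorm v.asIdeal : ℝ) ^ 2 ≤ Ideal.absNorm w.1.asIdeal := by exact_mod_cast h2
      have h3' : (2 : ℝ) ≤ Ideal.absNorm v.asIdeal := by exact_mod_cast h3
      calc (Ideal.absNorm w.1.asIdeal : ℝ) ^ (-s) ≤ ((Ideal.absNorm v.asIdeal : ℝ) ^ 2) ^ (-s) := 
            Real.rpow_le_rpow_of_nonpos (by positivity) h2' (by linarith)
        _ = (Ideal.absNorm v.asIdeal : ℝ) ^ (2 * -s) := by
            rw [Real.rpow_mul (by positivity)]; norm_num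
        _ ≤ _ := Real.rpow_le_rpow_of_exponent_le (by linarith) (by linarith)
  refine (Finset.sum_le_card_nsmul _ _ _ fun w _ => h w).trans ?_
  rw [nsmul_eq_mul, Finset.card_univ, ← Nat.card_eq_fintype_card]
  have := nt_nonneg F 2 v.asIdeal
  gcongr

lemma bdd_summable {a : HeightOneSpectrum (𝓞 F) → ℕ} {M : ℕ} (ha : ∀ v, a v ≤ M) {s : ℝ} (hs : 1 < s) :
    Summable fun v => (a v : ℝ) * nt F s v.asIdeal := by
  refine Summable.of_nonneg_of_le (fun v => mul_nonneg (by positivity) (nt_nonneg F s _)) (fun v => ?_) 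
    ((prime_summable F hs).mul_left (M : ℝ))
  have := nt_nonneg F s v.asIdeal
  have := ha v
  gcongr

lemma A_isBigO {K : Type*} [Field K] [NumberField K] [Algebra F K] [Algebra K L] [IsScalarTower F K L]
    {PP : HeightOneSpectrum (𝓞 F) → Ideal (𝓞 L)} (hp : ∀ v, (PP v).IsPrime)
    (hu : ∀ v, (PP v).under (𝓞 F) = v.asIdeal) (φ : HeightOneSpectrum (𝓞 F) → (L ≃ₐ[F] L))
    (hφ : ∀ v, IsArithFrobAt (𝓞 F) (φ v) (PP v))
    (H : Subgroup (L ≃ₐ[F] L))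
    (hH1 : ∀ τ ∈ H, ∀ x : 𝓞 K, τ • algebraMap (𝓞 K) (𝓞 L) x = algebraMap (𝓞 K) (𝓞 L) x)
    (hH2 : ∀ τ ∉ H, ∃ x : 𝓞 K, τ • algebraMap (𝓞 K) (𝓞 L) x ≠ algebraMap (𝓞 K) (𝓞 L) x) :
    (fun s => (∑' v, (Nat.card {g : L ≃ₐ[F] L // g⁻¹ * φ v * g ∈ H} : ℝ) * nt F s v.asIdeal) - 
      (Nat.card H : ℝ) * ell s) =O[𝓝[>] 1] (fun _ => (1 : ℝ)) := by
  classical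
  set a : HeightOneSpectrum (𝓞 F) → ℕ := fun v => Nat.card {g : L ≃ₐ[F] L // g⁻¹ * φ v * g ∈ H} with ha
  set M := Nat.card (L ≃ₐ[F] L) with hM
  have haM : ∀ v, a v ≤ M := fun v => Finite.card_subtype_le _
  have hbad := good_finite (K := K) hu H hH2
  set B := {v | ¬ Good K (PP v) H} with hB
  set D : HeightOneSpectrum (𝓞 F) → ℝ := fun v => (Nat.card H : ℝ) * (M * nt F 2 v.asIdeal) + 
    B.indicator (fun _ => (M + Nat.card H * M : ℝ)) v with hD
  have hDs : Summable D := by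
    refine Summable.add (((prime_summable F (s := 2) (by norm_num)).mul_left _).mul_left _) ?_
    exact summable_of_hasFiniteSupport (hbad.subset Set.support_indicator_subset)
  have h1 : (fun s => (∑' v, (a v : ℝ) * nt F s v.asIdeal) - (Nat.card H : ℝ) * SP K s) =O[𝓝[>] 1] (fun _ => (1 : ℝ)) := by
    refine IsBigO.of_bound (∑' v, D v) ?_
    filter_upwards [self_mem_nhdsWithin] with s hs
    have hs : 1 < s := hs
    rw [norm_one, mul_one]
    refine (((bdd_summable haM hs).hasSum).sub ((SP_fiber (F := F) K hs).mul_left (Nat.card H : ℝ))).norm_le_of_bounded hDs.hasSum fun v => ?_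
    have := hp v
    obtain ⟨hf1, hf2⟩ := fiber_fin (K := K) v (hu v)
    by_cases hv : v ∈ B
    · simp only [hD]
      rw [Set.indicator_of_mem hv]
      have e1 : 0 ≤ (a v : ℝ) * nt F s v.asIdeal := mul_nonneg (by positivity) (nt_nonneg F s _)
      have e2 : (a v : ℝ) * nt F s v.asIdeal ≤ M * 1 := by
        have := nt_nonneg F s v.asIdeal
        have := nt_le_one hs v
        have := haM v
        gcongr
      have e3 : 0 ≤ (Nat.card H : ℝ) * ∑' w : {w : HeightOneSpectrum (𝓞 K) // w.under (𝓞 F) = v}, nt K s w.1.asIdeal := 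
        mul_nonneg (by positivity) (tsum_nonneg fun w => nt_nonneg K s _)
      have e4 : ∑' w : {w : HeightOneSpectrum (𝓞 K) // w.under (𝓞 F) = v}, nt K s w.1.asIdeal ≤ M := by
        let _ := Fintype.ofFinite {w : HeightOneSpectrum (𝓞 K) // w.under (𝓞 F) = v}
        rw [tsum_fintype]
        refine (Finset.sum_le_card_nsmul _ _ 1 fun w _ => nt_le_one hs w.1).trans ?_
        rw [nsmul_eq_mul, mul_one, Finset.card_univ, ← Nat.card_eq_fintype_card]
        exact_mod_cast hf2
      have e5 : (Nat.card H : ℝ) * ∑' w : {w : HeightOneSpectrum (𝓞 K) // w.under (𝓞 F) = v}, nt K s w.1.asIdeal ≤ Nat.card H * M := by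
        gcongr
      have e6 : 0 ≤ (Nat.card H : ℝ) * (M * nt F 2 v.asIdeal) := by
        have := nt_nonneg F 2 v.asIdeal
        positivity
      rw [Real.norm_eq_abs, abs_le]
      constructor <;> linarith
    · simp only [hD]
      rw [Set.indicator_of_notMem hv, add_zero]
      have hv : Good K (PP v) H := not_not.1 hv
      have hc := count (K := K) (hu v) (hφ v) H hH1 hv
      simp only [ha]
      rw [hc, Nat.cast_mul, mul_assoc, ← mul_sub, norm_mul, Real.norm_natCast]
      gcongr
      exact local_bound hs v M hf1 hf2
  have h2 := (SP_isBigO K).const_mul_left (Nat.card H : ℝ)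
  refine (h1.add h2).congr_left fun s => ?_
  ring

lemma card_decomp {G : Type*} [Group G] [Finite G] (f : G → G) (H : Subgroup G) 
    [Fintype (Subgroup G)] [DecidablePred fun D : Subgroup G => D ≤ H] :
    Nat.card {g // f g ∈ H} = ∑ D with D ≤ H, Nat.card {g // Subgroup.zpowers (f g) = D} := by
  classical
  let _ := Fintype.ofFinite G
  simp_rw [Nat.card_eq_fintype_card, Fintype.card_subtype]
  rw [Finset.card_eq_sum_card_fiberwise (f := fun g => Subgroup.zpowers (f g)) (t := Finset.univ.filter (· ≤ H))]
  · refine Finset.sum_congr rfl fun D hD => ?_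
    congr 1
    ext g
    simp only [Finset.mem_filter, Finset.mem_univ, true_and] at hD ⊢
    refine ⟨fun h => h.2, fun h => ⟨?_, h⟩⟩
    rw [← Subgroup.zpowers_le, h]
    exact hD
  · intro g hg
    simpa [Subgroup.zpowers_le] using hg

lemma T_isBigO 
    {PP : HeightOneSpectrum (𝓞 F) → Ideal (𝓞 L)} (hp : ∀ v, (PP v).IsPrime)
    (hu : ∀ v, (PP v).under (𝓞 F) = v.asIdeal) (φ : HeightOneSpectrum (𝓞 F) → (L ≃ₐ[F] L))
    (hφ : ∀ v, IsArithFrobAt (𝓞 F) (φ v) (PP v))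
    (H : Subgroup (L ≃ₐ[F] L)) : 
    (fun s => (∑' v, (Nat.card {g : L ≃ₐ[F] L // Subgroup.zpowers (g⁻¹ * φ v * g) = H} : ℝ) * nt F s v.asIdeal) - 
      (Nat.card {g : L ≃ₐ[F] L // Subgroup.zpowers g = H} : ℝ) * ell s) =O[𝓝[>] 1] (fun _ => (1 : ℝ)) := by
  classical
  let _ := Fintype.ofFinite (Subgroup (L ≃ₐ[F] L))
  induction H using WellFoundedLT.induction with
  | ind H ih =>
  have hA := A_isBigO (K := IntermediateField.fixedField H) hp hu φ hφ H ?_ ?_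
  rotate_left
  · intro τ hτ x
    apply RingOfIntegers.ext
    exact x.1.2 ⟨τ, hτ⟩
  · intro τ hτ
    by_contra hcon
    push Not at hcon
    apply hτ
    rw [← IntermediateField.fixingSubgroup_fixedField H, IntermediateField.mem_fixingSubgroup_iff]
    intro x hx
    obtain ⟨y, z, hz, hyz⟩ := IsFractionRing.div_surjective (A := 𝓞 (IntermediateField.fixedField H)) 
      (⟨x, hx⟩ : IntermediateField.fixedField H)
    have e : ∀ y : 𝓞 (IntermediateField.fixedField H), τ (y : IntermediateField.fixedField H).1 = (y : IntermediateField.fixedField H).1 := by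
      intro y
      exact congrArg (fun t : 𝓞 L => (t : L)) (hcon y)
    have hx' := congrArg Subtype.val hyz
    change (y : IntermediateField.fixedField H).1 / (z : IntermediateField.fixedField H).1 = x at hx'
    rw [← hx', map_div₀, e, e]
  have hsum := IsBigO.sum (s := Finset.univ.filter (fun D => D < H)) (g := fun _ => (1 : ℝ)) 
    fun D hD => ih D (Finset.mem_filter.1 hD).2
  refine (hA.sub hsum).congr' ?_ EventuallyEq.rfl
  filter_upwards [self_mem_nhdsWithin] with s hs
  have hs : 1 < s := hs
  have hins : Finset.univ.filter (fun D => D ≤ H) = insert H (Finset.univ.filter (fun D => D < H)) := by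
    ext D; simp [le_iff_eq_or_lt]
  have hni : H ∉ Finset.univ.filter (fun D => D < H) := by simp
  have hsm : ∀ D : Subgroup (L ≃ₐ[F] L), Summable fun v => 
    (Nat.card {g : L ≃ₐ[F] L // Subgroup.zpowers (g⁻¹ * φ v * g) = D} : ℝ) * nt F s v.asIdeal := 
    fun D => bdd_summable (fun v => Finite.card_subtype_le _) hs
  have e1 : ∑' v, (Nat.card {g : L ≃ₐ[F] L // g⁻¹ * φ v * g ∈ H} : ℝ) * nt F s v.asIdeal = 
     ∑ D with D ≤ H, ∑' v, (Nat.card {g : L ≃ₐ[F] L // Subgroup.zpowers (g⁻¹ * φ v * g) = D} : ℝ) * nt F s v.asIdeal := by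
    rw [← Summable.tsum_finsetSum fun D _ => hsm D]
    refine tsum_congr fun v => ?_
    rw [card_decomp (fun g => g⁻¹ * φ v * g) H, Nat.cast_sum, Finset.sum_mul]
  have e2 : (Nat.card H : ℝ) = ∑ D with D ≤ H, (Nat.card {g : L ≃ₐ[F] L // Subgroup.zpowers g = D} : ℝ) := by
    rw [← Nat.cast_sum, ← card_decomp (fun g : L ≃ₐ[F] L => g) H]
  rw [e1, e2, hins, Finset.sum_insert hni, Finset.sum_insert hni]
  rw [Finset.sum_apply, Finset.sum_sub_distrib, ← Finset.sum_mul]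
  ring

/-- Frobenius' density theorem, existence part. -/
theorem exists_frobenius (σ : L ≃ₐ[F] L) (S : Set (HeightOneSpectrum (𝓞 F))) (hS : S.Finite) :
    ∃ (v : HeightOneSpectrum (𝓞 F)) (P : Ideal (𝓞 L)) (φ g : L ≃ₐ[F] L), v ∉ S ∧ P.IsPrime ∧ 
      P.under (𝓞 F) = v.asIdeal ∧ IsArithFrobAt (𝓞 F) φ P ∧ σ ∈ Subgroup.zpowers (g⁻¹ * φ * g) := by
  classical
  choose PP φ hp hu hφ using fun v : HeightOneSpectrum (𝓞 F) => exists_frob (L := L) v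
  by_contra hcon
  push Not at hcon
  have hT := T_isBigO hp hu φ hφ (Subgroup.zpowers σ)
  have hz : ∀ v ∉ S, Nat.card {g : L ≃ₐ[F] L // Subgroup.zpowers (g⁻¹ * φ v * g) = Subgroup.zpowers σ} = 0 := by
    intro v hv
    rw [Nat.card_eq_zero]
    left
    refine ⟨fun ⟨g, hg⟩ => hcon v (PP v) (φ v) g hv (hp v) (hu v) (hφ v) ?_⟩
    rw [hg]
    exact Subgroup.mem_zpowers σ
  have hb : (fun s => ∑' v, (Nat.card {g : L ≃ₐ[F] L // Subgroup.zpowers (g⁻¹ * φ v * g) = Subgroup.zpowers σ} : ℝ) * nt F s v.asIdeal) =O[𝓝[>] 1] (fun _ => (1 : ℝ)) := by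
    refine IsBigO.of_bound (∑ v ∈ hS.toFinset, (Nat.card (L ≃ₐ[F] L) : ℝ)) ?_
    filter_upwards [self_mem_nhdsWithin] with s hs
    have hs : 1 < s := hs
    rw [tsum_eq_sum (s := hS.toFinset) (fun v hv => by rw [hz v (by simpa using hv)]; simp), norm_one, mul_one]
    refine (norm_sum_le _ _).trans (Finset.sum_le_sum fun v _ => ?_)
    rw [Real.norm_of_nonneg (mul_nonneg (by positivity) (nt_nonneg F s _))]
    have h1 := nt_le_one hs v
    have h0 := nt_nonneg F s v.asIdeal
    have h2 : Nat.card {g : L ≃ₐ[F] L // Subgroup.zpowers (g⁻¹ * φ v * g) = Subgroup.zpowers σ} ≤ Nat.card (L ≃ₐ[F] L) := Finite.card_subtype_le _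
    calc _ ≤ (Nat.card (L ≃ₐ[F] L) : ℝ) * 1 := by gcongr
      _ = _ := mul_one _
  have h3 := hb.sub hT
  simp only [sub_sub_cancel] at h3
  have hpos : (Nat.card {g : L ≃ₐ[F] L // Subgroup.zpowers g = Subgroup.zpowers σ} : ℝ) ≠ 0 := by
    have : Nonempty {g : L ≃ₐ[F] L // Subgroup.zpowers g = Subgroup.zpowers σ} := ⟨⟨σ, rfl⟩⟩
    exact_mod_cast Nat.card_pos.ne'
  have h4 := (isBigO_const_mul_left_iff hpos).1 h3
  have h5 : Tendsto ell (𝓝[>] 1) atTop := by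
    unfold ell
    refine tendsto_neg_atBot_atTop.comp (Real.tendsto_log_nhdsGT_zero.comp ?_)
    refine tendsto_nhdsWithin_iff.2 ⟨?_, ?_⟩
    · refine tendsto_nhdsWithin_of_tendsto_nhds ?_
      have : Tendsto (fun s : ℝ => s - 1) (𝓝 1) (𝓝 (1 - 1)) := (continuous_id.sub continuous_const).tendsto 1
      simpa using this
    · filter_upwards [self_mem_nhdsWithin] with s hs
      have hs : (1:ℝ) < s := hs
      exact sub_pos.2 hs
  exact not_isBoundedUnder_of_tendsto_atTop (tendsto_norm_atTop_atTop.comp h5) ((isBigO_one_iff ℝ).1 h4)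
end Combine

section Final

lemma exp_not_pow {n : ℕ} (hn : 2 ≤ n) (x : WithZero (Multiplicative ℤ)) : x ^ n ≠ WithZero.exp (-1) := by
  intro h
  have h1 := congrArg WithZero.log h
  rw [WithZero.log_pow, WithZero.log_exp, nsmul_eq_mul] at h1
  have : (n : ℤ) ∣ 1 := ⟨-x.log, by linarith⟩
  have := Int.le_of_dvd one_pos this
  omega

variable {F : Type*} [Field F] [NumberField F]

lemma val_eval_eq_one (v : HeightOneSpectrum (𝓞 F)) (p : (𝓞 F)[X]) (hp : ∀ a, p.eval a ∉ v.asIdeal)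
    (u : F) (hu : v.valuation F u ≤ 1) : v.valuation F (p.eval₂ (algebraMap (𝓞 F) F) u) = 1 := by
  obtain ⟨a, ha⟩ := v.exists_valuation_sub_lt_of_integer hu (γ := 1)
  let O := (v.valuation F).integer
  let f : 𝓞 F →+* O := (algebraMap (𝓞 F) F).codRestrict O (fun x => v.valuation_le_one x)
  have hf : O.subtype.comp f = algebraMap (𝓞 F) F := rfl
  obtain ⟨c, hc⟩ := sub_dvd_eval_sub (⟨u, hu⟩ : O) (f a) (p.map f)
  have hc := congrArg O.subtype hc
  rw [map_sub, map_mul, map_sub, eval_map, eval_map, hom_eval₂, hom_eval₂, hf] at hc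
  change eval₂ _ u p - eval₂ _ (algebraMap (𝓞 F) F a) p = (u - algebraMap (𝓞 F) F a) * c at hc
  rw [eval₂_at_apply] at hc
  have h1 : v.valuation F (algebraMap (𝓞 F) F (p.eval a)) = 1 := (HeightOneSpectrum.valuation_eq_one_iff_notMem v).2 (hp a)
  rw [← h1]
  apply Valuation.map_eq_of_sub_lt
  rw [hc, h1, map_mul]
  exact mul_lt_one_of_lt_of_le (by rw [Valuation.map_sub_swap]; simpa using ha) c.2

lemma val_form (v : HeightOneSpectrum (𝓞 F)) (p : (𝓞 F)[X]) (hp : ∀ a, p.eval a ∉ v.asIdeal)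
    (hl : p.leadingCoeff ∉ v.asIdeal) {N : ℕ} (hN : p.natDegree = N) (t z : F) (h : t ≠ 0 ∨ z ≠ 0) :
    ∃ γ : F, γ ≠ 0 ∧ v.valuation F (∑ i ∈ Finset.range (N + 1), (algebraMap (𝓞 F) F (p.coeff i)) * t ^ i * z ^ (N - i))
      = v.valuation F γ ^ N := by
  by_cases htz : v.valuation F t ≤ v.valuation F z
  · have hz : z ≠ 0 := by
      rintro rfl
      rw [map_zero, le_zero_iff, map_eq_zero] at htz
      simp [htz] at h
    refine ⟨z, hz, ?_⟩
    have hu : v.valuation F (t / z) ≤ 1 := by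
      rw [map_div₀]
      exact div_le_one_of_le₀ htz zero_le
    have := val_eval_eq_one v p hp _ hu
    rw [← one_mul (_ ^ N), ← this, ← map_pow, ← map_mul, eval₂_eq_sum_range, hN, Finset.sum_mul]
    congr 1
    refine Finset.sum_congr rfl fun i hi => ?_
    have hi : i ≤ N := Nat.lt_succ_iff.1 (Finset.mem_range.1 hi)
    rw [div_pow, ← pow_mul_pow_sub z hi]
    field_simp
  · push Not at htz
    have ht : t ≠ 0 := by
      rintro rfl
      simp at htz
    refine ⟨t, ht, ?_⟩
    have hvt : 0 < v.valuation F t := zero_lt_iff.2 (by simpa using ht)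
    have e : v.valuation F (algebraMap (𝓞 F) F (p.coeff N) * t ^ N * z ^ (N - N)) = v.valuation F t ^ N := by
      rw [Nat.sub_self, pow_zero, mul_one, map_mul, map_pow, ← hN]
      have : v.valuation F (algebraMap (𝓞 F) F (p.leadingCoeff)) = 1 := (HeightOneSpectrum.valuation_eq_one_iff_notMem v).2 hl
      rw [coeff_natDegree, this, one_mul]
    rw [Finset.sum_range_succ, Valuation.map_add_eq_of_lt_right, e]
    rw [e]
    refine Valuation.map_sum_lt _ (pow_pos hvt _).ne' fun i hi => ?_
    have hi : i < N := Finset.mem_range.1 hi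
    rw [map_mul, map_mul, map_pow, map_pow, mul_assoc]
    refine mul_lt_of_le_one_of_lt (v.valuation_le_one _) ?_
    rw [← pow_mul_pow_sub _ hi.le]
    have : 0 < v.valuation F t ^ i := pow_pos hvt _
    refine mul_lt_mul_of_pos_left ?_ this
    exact pow_lt_pow_left₀ htz zero_le (by omega)

lemma final_val (v : HeightOneSpectrum (𝓞 F)) (p : (𝓞 F)[X]) (hp : ∀ a, p.eval a ∉ v.asIdeal)
    (hl : p.leadingCoeff ∉ v.asIdeal) {n N : ℕ} (hn : 2 ≤ n) (hN0 : 0 < N) (hnN : n ∣ N) (hN : p.natDegree = N) :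
    ∃ d : 𝓞 F, d ≠ 0 ∧ (¬ ∃ c : 𝓞 F, c ^ n = d) ∧
      ¬ ∃ y t z : F, (y, t, z) ≠ (0, 0, 0) ∧
        y ^ n = (algebraMap (𝓞 F) F d) *
          ∑ i ∈ Finset.range (N + 1), (algebraMap (𝓞 F) F (p.coeff i)) * t ^ i * z ^ (N - i) := by
  obtain ⟨d, hd⟩ := v.valuation_exists_uniformizer' F
  have hd : v.valuation F (algebraMap (𝓞 F) F d) = WithZero.exp (-1) := hd
  refine ⟨d, ?_, ?_, ?_⟩
  · rintro rfl
    rw [map_zero, map_zero] at hd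
    exact WithZero.exp_ne_zero hd.symm
  · rintro ⟨c, rfl⟩
    rw [map_pow, map_pow] at hd
    exact exp_not_pow hn _ hd
  · rintro ⟨y, t, z, h0, h⟩
    by_cases h1 : t ≠ 0 ∨ z ≠ 0
    · obtain ⟨γ, hγ, h2⟩ := val_form v p hp hl hN t z h1
      obtain ⟨k, rfl⟩ := hnN
      have h3 := congrArg (v.valuation F) h
      rw [map_mul, h2, hd, map_pow, mul_comm n k, pow_mul] at h3
      have hγ : v.valuation F γ ^ k ≠ 0 := pow_ne_zero _ (by simpa using hγ)
      apply exp_not_pow hn (v.valuation F y / v.valuation F γ ^ k)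
      rw [div_pow, h3, mul_div_cancel_right₀ _ (pow_ne_zero _ hγ)]
    · push Not at h1
      obtain ⟨rfl, rfl⟩ := h1
      rw [Finset.sum_eq_zero, mul_zero] at h
      · have := pow_eq_zero_iff (by omega) |>.1 h
        simp [this] at h0
      · intro i hi
        rcases Nat.eq_zero_or_pos i with rfl | hi
        · simp [hN0.ne']
        · simp [hi.ne']
end Final

section Prime
variable {F L : Type*} [Field F] [NumberField F] [Field L] [NumberField L] [Algebra F L] [IsGalois F L]

lemma exists_prime (p : (𝓞 F)[X]) (hdeg : 0 < p.natDegree)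
    (hs : (p.map ((algebraMap F L).comp (algebraMap (𝓞 F) F))).Splits) (σ : L ≃ₐ[F] L)
    (hσ : ∀ t : L, p.eval₂ ((algebraMap F L).comp (algebraMap (𝓞 F) F)) t = 0 → σ t ≠ t) :
    ∃ v : HeightOneSpectrum (𝓞 F), p.leadingCoeff ∉ v.asIdeal ∧ ∀ a, p.eval a ∉ v.asIdeal := by
  classical
  set f : 𝓞 F →+* L := (algebraMap F L).comp (algebraMap (𝓞 F) F) with hf
  have hfinj : Function.Injective f := (algebraMap F L).injective.comp RingOfIntegers.coe_injective
  set g := algebraMap (𝓞 F) (𝓞 L) with hg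
  have hgf : ∀ x, ((g x : 𝓞 L) : L) = f x := fun x => rfl
  have hp0 : p ≠ 0 := by rintro rfl; simp at hdeg
  have hlc : p.leadingCoeff ≠ 0 := leadingCoeff_ne_zero.2 hp0
  set R := (p.map f).roots with hR
  have hroot : ∀ t ∈ R, p.eval₂ f t = 0 := by
    intro t ht
    have := (mem_roots'.1 ht).2
    rwa [IsRoot, eval_map] at this
  have hint : ∀ t, ∃ r : 𝓞 L, t ∈ R → (r : L) = f p.leadingCoeff * t := by
    intro t
    by_cases ht : t ∈ R
    · have h1 := f.isIntegralElem_leadingCoeff_mul p t (hroot t ht)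
      have h2 : IsIntegral ℤ (f p.leadingCoeff * t) := by
        let _ := f.toAlgebra
        have h1 : IsIntegral (𝓞 F) (f p.leadingCoeff * t) := h1
        exact isIntegral_trans (R := ℤ) _ h1
      exact ⟨⟨_, h2⟩, fun _ => rfl⟩
    · exact ⟨0, fun h => absurd h ht⟩
  choose r hr using hint
  let Bad : 𝓞 L → Set (HeightOneSpectrum (𝓞 F)) := fun y => {v | v.asIdeal ∣ (Ideal.span {y}).under (𝓞 F)}
  have hBad : ∀ y ≠ 0, (Bad y).Finite := fun y hy =>
    Ideal.finite_factors (Ideal.under_ne_bot _ (by simpa using hy))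
  have hBad2 : ∀ (y : 𝓞 L) (v : HeightOneSpectrum (𝓞 F)) (P : Ideal (𝓞 L)), P.under (𝓞 F) = v.asIdeal → y ∈ P → v ∈ Bad y := by
    intro y v P hu hy
    refine Ideal.dvd_iff_le.2 ?_
    rw [← hu]
    exact Ideal.comap_mono ((Ideal.span_singleton_le_iff_mem _).2 hy)
  let Y : Finset (𝓞 L) := (insert (g p.leadingCoeff) (((Finset.univ : Finset (L ≃ₐ[F] L)) ×ˢ R.toFinset).image
    (fun x => x.1 • r x.2 - r x.2))).filter (· ≠ 0)
  have hS : (⋃ y ∈ Y, Bad y).Finite := Y.finite_toSet.biUnion fun y hy => hBad y (Finset.mem_filter.1 hy).2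
  obtain ⟨v, P, φ, τ, hvS, hP, hu, hφ, hστ⟩ := exists_frobenius σ _ hS
  have hY : ∀ y ∈ Y, y ∉ P := fun y hy hyP => hvS (Set.mem_biUnion hy (hBad2 y v P hu hyP))
  have hmem : ∀ x : 𝓞 F, x ∈ v.asIdeal ↔ g x ∈ P := by
    intro x; rw [← hu]; rfl
  have hl : g p.leadingCoeff ∉ P := by
    apply hY
    refine Finset.mem_filter.2 ⟨Finset.mem_insert_self _ _, fun h => hlc (hfinj ?_)⟩
    rw [← hgf, h, map_zero]; rfl
  refine ⟨v, fun h => hl ((hmem _).1 h), fun a ha => ?_⟩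
  rw [hmem] at ha
  have hprod : g p.leadingCoeff ^ p.natDegree * g (p.eval a) =
      g p.leadingCoeff * (R.map (fun t => g (p.leadingCoeff * a) - r t)).prod := by
    apply RingOfIntegers.ext
    have hc : Multiset.card R = p.natDegree := by
      rw [hR, ← hs.natDegree_eq_card_roots, natDegree_map_eq_of_injective hfinj]
    have e1 : f (p.eval a) = f p.leadingCoeff * (R.map (fun t => f a - t)).prod := by
      rw [← eval₂_at_apply, ← eval_map, hs.eq_prod_roots, eval_mul, eval_C, leadingCoeff_map_of_injective hfinj, eval_multiset_prod,
        Multiset.map_map, ← hR]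
      simp
    change algebraMap (𝓞 L) L _ = algebraMap (𝓞 L) L _
    rw [map_mul (algebraMap (𝓞 L) L), map_mul (algebraMap (𝓞 L) L), map_pow (algebraMap (𝓞 L) L),
      map_multiset_prod (algebraMap (𝓞 L) L), Multiset.map_map]
    change f p.leadingCoeff ^ _ * f _ = f p.leadingCoeff * _
    have e3 : R.map (algebraMap (𝓞 L) L ∘ fun t => g (p.leadingCoeff * a) - r t) =
        R.map (fun t => f p.leadingCoeff * (f a - t)) := by
      refine Multiset.map_congr rfl fun t ht => ?_
      rw [Function.comp_apply, map_sub]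
      change f (p.leadingCoeff * a) - (r t : L) = _
      rw [hr t ht, map_mul]
      ring
    rw [e1, e3, Multiset.prod_map_mul, Multiset.map_const', Multiset.prod_replicate, hc]
    ring
  have hx : (R.map (fun t => g (p.leadingCoeff * a) - r t)).prod ∈ P := by
    have : g p.leadingCoeff * (R.map (fun t => g (p.leadingCoeff * a) - r t)).prod ∈ P := by
      rw [← hprod]; exact P.mul_mem_left _ ha
    exact (hP.mem_or_mem this).resolve_left hl
  have hx2 : ∃ t ∈ R, g (p.leadingCoeff * a) - r t ∈ P := by
    by_contra hcon
    push Not at hcon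
    have := multiset_prod_mem (S := P.primeCompl) (R.map (fun t => g (p.leadingCoeff * a) - r t)) (by
      intro x hx
      obtain ⟨t, ht, rfl⟩ := Multiset.mem_map.1 hx
      exact hcon t ht)
    exact this hx
  obtain ⟨t, ht, htP⟩ := hx2
  have hφr : φ • r t - r t ∈ P := by
    set b := g (p.leadingCoeff * a) with hb
    have hφb : φ • b = b := smul_algebraMap φ _
    have h1 := hφ (r t)
    have h2 := hφ b
    change φ • r t - r t ^ Nat.card (𝓞 F ⧸ P.under (𝓞 F)) ∈ P at h1
    change φ • b - b ^ Nat.card (𝓞 F ⧸ P.under (𝓞 F)) ∈ P at h2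
    have h3 := P.mem_of_dvd (sub_dvd_pow_sub_pow b (r t) (Nat.card (𝓞 F ⧸ P.under (𝓞 F)))) htP
    rw [hφb] at h2
    have h4 := P.add_mem (P.sub_mem (P.add_mem h1 htP) h2) (P.zero_mem)
    have h5 := P.sub_mem h4 h3
    convert h5 using 1
    ring
  have hfix : φ • r t = r t := by
    by_contra hne
    refine hY _ (Finset.mem_filter.2 ⟨Finset.mem_insert_of_mem (Finset.mem_image.2 ⟨(φ, t), ?_, rfl⟩), sub_ne_zero.2 hne⟩) hφr
    simpa using ht
  have hfix2 : φ t = t := by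
    have h1 : φ (r t : L) = (r t : L) := congrArg (fun x : 𝓞 L => (x : L)) hfix
    rw [hr t ht, map_mul] at h1
    have h2 : φ (f p.leadingCoeff) = f p.leadingCoeff := φ.commutes _
    rw [h2] at h1
    exact mul_left_cancel₀ (by rw [Ne, map_eq_zero_iff f hfinj]; exact hlc) h1
  have hst : ∀ ρ ∈ Subgroup.zpowers (τ⁻¹ * φ * τ), ρ (τ⁻¹ t) = τ⁻¹ t := by
    intro ρ hρ
    have : Subgroup.zpowers (τ⁻¹ * φ * τ) ≤ MulAction.stabilizer (L ≃ₐ[F] L) (τ⁻¹ t) := by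
      rw [Subgroup.zpowers_le, MulAction.mem_stabilizer_iff]
      change τ⁻¹ (φ (τ (τ⁻¹ t))) = τ⁻¹ t
      rw [← AlgEquiv.mul_apply τ, mul_inv_cancel, AlgEquiv.one_apply, hfix2]
    exact this hρ
  refine hσ (τ⁻¹ t) ?_ (hst σ hστ)
  have h1 := congrArg (τ⁻¹ : L ≃ₐ[F] L).toRingEquiv.toRingHom (hroot t ht)
  rw [hom_eval₂, map_zero] at h1
  have h2 : (τ⁻¹ : L ≃ₐ[F] L).toRingEquiv.toRingHom.comp f = f := by
    ext x
    exact (τ⁻¹ : L ≃ₐ[F] L).commutes _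
  rw [h2] at h1
  exact h1
end Prime

end FrobDens

/-- Main theorem: if every root of `P` has multiplicity at most `n-1` and the Galois group of
`P` over `F` has an element fixing no root, then some twist `Yⁿ = d·P(T,Z)` (with `d` not an
`n`-th power in `O_F`) has no `F`-rational point in the weighted projective space. -/
theorem stmt3 (F : Type*) [Field F] [NumberField F] (n N : ℕ) (hn : 2 ≤ n)
    (hN : 0 < N) (hnN : n ∣ N) (p : Polynomial (𝓞 F)) (hdeg : p.natDegree = N)
    (hmult : ∀ t : AlgebraicClosure F,
      ((p.map (algebraMap (𝓞 F) F)).map (algebraMap F (AlgebraicClosure F))).rootMultiplicity t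
        ≤ n - 1)
    (hGal : ∃ σ : (p.map (algebraMap (𝓞 F) F)).SplittingField ≃ₐ[F]
        (p.map (algebraMap (𝓞 F) F)).SplittingField,
      ∀ t : (p.map (algebraMap (𝓞 F) F)).SplittingField,
        aeval t (p.map (algebraMap (𝓞 F) F)) = 0 → σ t ≠ t) :
    ∃ d : 𝓞 F, d ≠ 0 ∧ (¬ ∃ c : 𝓞 F, c ^ n = d) ∧
      ¬ ∃ y t z : F, (y, t, z) ≠ (0, 0, 0) ∧
        y ^ n = (algebraMap (𝓞 F) F d) *
          ∑ i ∈ Finset.range (N + 1), (algebraMap (𝓞 F) F (p.coeff i)) * t ^ i * z ^ (N - i) := by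
  set q := p.map (algebraMap (𝓞 F) F) with hq
  obtain ⟨σ, hσ⟩ := hGal
  have : CharZero q.SplittingField := charZero_of_injective_algebraMap (algebraMap F q.SplittingField).injective
  have : NumberField q.SplittingField := NumberField.of_module_finite F q.SplittingField
  have : IsGalois F q.SplittingField := {}
  have hs : (p.map ((algebraMap F q.SplittingField).comp (algebraMap (𝓞 F) F))).Splits := by
    rw [← Polynomial.map_map]
    exact SplittingField.splits q
  obtain ⟨v, hl, hp⟩ := FrobDens.exists_prime p (by omega) hs σ (by
    intro t ht
    apply hσ
    rw [aeval_def]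
    exact (eval₂_map (algebraMap (𝓞 F) F) (algebraMap F q.SplittingField) t).trans ht)
  exact FrobDens.final_val v p hp hl hn hN hnN hdeg
end

section
/- For each integer n ≥ 2, the number of tuples (a_0,…,a_n) ∈ Z^{n+1} with |a_i| ≤ H for all i, a_n ≠ 0, and gcd(a_0,…,a_n) = 1 equals (2^{n+1}/ζ(n+1))·H^{n+1} + O(H^n) as H → ∞, where ζ is the Riemann zeta function. -/
open Filter

open scoped ArithmeticFunction.Moebius ArithmeticFunction.zeta LSeries.notation in
lemma aux_zeta (n : ℕ) (hn : 2 ≤ n) :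
    (∑' k : ℕ, 1 / ((k : ℝ) + 1) ^ (n + 1)) *
      (∑' d : ℕ, (ArithmeticFunction.moebius d : ℝ) / (d : ℝ) ^ (n + 1)) = 1 := by
  have hs : 1 < (((n + 1 : ℕ) : ℂ)).re := by
    rw [Complex.natCast_re]; exact_mod_cast (by omega : 1 < n + 1)
  have h := ArithmeticFunction.LSeries_zeta_mul_Lseries_moebius hs
  rw [ArithmeticFunction.LSeries_zeta_eq_riemannZeta hs,
    zeta_nat_eq_tsum_of_gt_one (by omega)] at h
  have h1 : (∑' m : ℕ, 1 / (m : ℂ) ^ (n + 1)) =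
      ((∑' k : ℕ, 1 / ((k : ℝ) + 1) ^ (n + 1) : ℝ) : ℂ) := by
    have hsum : Summable (fun m : ℕ => 1 / (m : ℝ) ^ (n + 1)) :=
      Real.summable_one_div_nat_pow.mpr (by omega)
    have := hsum.tsum_eq_zero_add
    have e : (∑' k : ℕ, 1 / ((k : ℝ) + 1) ^ (n + 1)) = ∑' m : ℕ, 1 / (m : ℝ) ^ (n + 1) := by
      rw [this]; simp
    rw [e, Complex.ofReal_tsum]
    push_cast; rfl
  have h2 : LSeries (fun m => ((ArithmeticFunction.moebius m : ℤ) : ℂ)) ((n + 1 : ℕ) : ℂ) =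
      ((∑' d : ℕ, (ArithmeticFunction.moebius d : ℝ) / (d : ℝ) ^ (n + 1) : ℝ) : ℂ) := by
    rw [Complex.ofReal_tsum, LSeries]
    refine tsum_congr fun m => ?_
    rw [LSeries.term_def₀ (by simp), Complex.cpow_neg, Complex.cpow_natCast]
    push_cast
    rw [div_eq_mul_inv]
  rw [h1, h2] at h
  exact_mod_cast h

lemma aux_moebius (g : ℕ) (hg : g ≠ 0) (N : ℕ) (hN : g ≤ N) :
    (∑ d ∈ Finset.range (N + 1), if d ∣ g then ArithmeticFunction.moebius d else 0) =
      if g = 1 then 1 else 0 := by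
  have h := congrArg (fun f => f g) ArithmeticFunction.coe_zeta_mul_moebius
  simp only [ArithmeticFunction.coe_zeta_mul_apply, ArithmeticFunction.one_apply] at h
  rw [← h, ← Finset.sum_filter]
  refine Finset.sum_congr ?_ fun _ _ => rfl
  ext d
  simp only [Finset.mem_filter, Finset.mem_range, Nat.mem_divisors]
  constructor
  · rintro ⟨_, h⟩; exact ⟨h, hg⟩
  · rintro ⟨h, _⟩
    exact ⟨by have := Nat.le_of_dvd (Nat.pos_of_ne_zero hg) h; omega, h⟩

lemma aux_filter (N d : ℕ) (hd : 0 < d) :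
    (Finset.Icc (-(N : ℤ)) N).filter (fun x => (d : ℤ) ∣ x) =
      (Finset.Icc (-((N / d : ℕ) : ℤ)) ((N / d : ℕ) : ℤ)).image (fun x => (d : ℤ) * x) := by
  have hd' : (0 : ℤ) < d := by exact_mod_cast hd
  ext x
  simp only [Finset.mem_filter, Finset.mem_Icc, Finset.mem_image]
  push_cast
  constructor
  · rintro ⟨⟨h1, h2⟩, k, rfl⟩
    refine ⟨k, ⟨?_, ?_⟩, rfl⟩
    · have : -k ≤ (N : ℤ) / d := by
        rw [Int.le_ediv_iff_mul_le hd']; linarith [mul_comm k (d : ℤ)]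
      linarith
    · rw [Int.le_ediv_iff_mul_le hd']; linarith [mul_comm k (d : ℤ)]
  · rintro ⟨k, ⟨h1, h2⟩, rfl⟩
    have h1' : -k ≤ (N : ℤ) / d := by linarith
    rw [Int.le_ediv_iff_mul_le hd'] at h1' h2
    exact ⟨⟨by linarith [mul_comm k (d : ℤ)], by linarith [mul_comm k (d : ℤ)]⟩, dvd_mul_right _ _⟩

lemma aux_card1 (N d : ℕ) (hd : 0 < d) :
    ((Finset.Icc (-(N : ℤ)) N).filter (fun x => (d : ℤ) ∣ x)).card = 2 * (N / d) + 1 := by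
  have hd' : (d : ℤ) ≠ 0 := by exact_mod_cast hd.ne'
  rw [aux_filter N d hd, Finset.card_image_of_injective _ (mul_right_injective₀ hd'),
    Int.card_Icc]
  omega

lemma aux_card2 (N d : ℕ) (hd : 0 < d) :
    ((Finset.Icc (-(N : ℤ)) N).filter (fun x => (d : ℤ) ∣ x ∧ x ≠ 0)).card = 2 * (N / d) := by
  have : (Finset.Icc (-(N : ℤ)) N).filter (fun x => (d : ℤ) ∣ x ∧ x ≠ 0) =
      ((Finset.Icc (-(N : ℤ)) N).filter (fun x => (d : ℤ) ∣ x)).erase 0 := by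
    ext x; simp only [Finset.mem_filter, Finset.mem_erase]; tauto
  rw [this, Finset.card_erase_of_mem (by simp), aux_card1 N d hd]
  omega

/-- vectors in the box, with nonzero last coordinate, all divisible by `d`. -/
noncomputable def auxBox (n N d : ℕ) : Finset (Fin (n + 1) → ℤ) :=
  Fintype.piFinset fun i => (Finset.Icc (-(N : ℤ)) N).filter
    (fun x => (d : ℤ) ∣ x ∧ (i = Fin.last n → x ≠ 0))

lemma auxBox_card (n N d : ℕ) (hd : 0 < d) :
    (auxBox n N d).card = (2 * (N / d)) * (2 * (N / d) + 1) ^ n := by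
  rw [auxBox, Fintype.card_piFinset, Fin.prod_univ_castSucc]
  simp only [Fin.castSucc_ne_last, false_imp_iff, and_true, true_imp_iff]
  rw [aux_card2 N d hd, aux_card1 N d hd]
  simp [mul_comm]

lemma auxBox_mem (n N d : ℕ) (a : Fin (n + 1) → ℤ) :
    a ∈ auxBox n N d ↔ a ∈ auxBox n N 1 ∧ d ∣ (Finset.univ.gcd a).natAbs := by
  rw [← Int.natCast_dvd, Finset.dvd_gcd_iff]
  simp only [auxBox, Fintype.mem_piFinset, Finset.mem_filter, Finset.mem_univ, true_imp_iff,
    Nat.cast_one, isUnit_one, IsUnit.dvd, true_and]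
  constructor
  · intro h; exact ⟨fun i => ⟨(h i).1, (h i).2.2⟩, fun i => (h i).2.1⟩
  · intro h i; exact ⟨(h.1 i).1, h.2 i, (h.1 i).2⟩

lemma aux_count (n N : ℕ) :
    (((auxBox n N 1).filter (fun a => Finset.univ.gcd a = 1)).card : ℤ) =
      ∑ d ∈ Finset.range (N + 1), ArithmeticFunction.moebius d *
        (((2 * (N / d)) * (2 * (N / d) + 1) ^ n : ℕ) : ℤ) := by
  have h1 : ∀ d ∈ Finset.range (N + 1), ArithmeticFunction.moebius d *
        (((2 * (N / d)) * (2 * (N / d) + 1) ^ n : ℕ) : ℤ) =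
      ∑ a ∈ auxBox n N 1,
        if d ∣ (Finset.univ.gcd a).natAbs then ArithmeticFunction.moebius d else 0 := by
    intro d _
    rcases Nat.eq_zero_or_pos d with rfl | hd
    · simp
    rw [← auxBox_card n N d hd, ← Finset.sum_filter, Finset.sum_const, nsmul_eq_mul, mul_comm]
    congr 3
    ext a
    rw [auxBox_mem, Finset.mem_filter]
  rw [Finset.sum_congr rfl h1, Finset.sum_comm, Finset.card_filter]
  push_cast
  refine Finset.sum_congr rfl fun a ha => ?_
  simp only [auxBox, Fintype.mem_piFinset, Finset.mem_filter, Finset.mem_Icc] at ha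
  obtain ⟨⟨h2, h3⟩, -, h4⟩ := ha (Fin.last n)
  have h4 := h4 rfl
  have hdv : Finset.univ.gcd a ∣ a (Fin.last n) := Finset.gcd_dvd (Finset.mem_univ _)
  have hdv' := Int.natAbs_dvd_natAbs.mpr hdv
  have hle := Nat.le_of_dvd (Int.natAbs_pos.mpr h4) hdv'
  rw [aux_moebius _ _ N (by omega)]
  · have hn : 0 ≤ Finset.univ.gcd a := by
      rw [← Finset.normalize_gcd, ← Int.abs_eq_normalize]; exact abs_nonneg _
    have : (Finset.univ.gcd a).natAbs = 1 ↔ Finset.univ.gcd a = 1 := by omega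
    simp only [this]
  · intro h0
    rw [Int.natAbs_eq_zero] at h0
    rw [h0] at hdv
    exact h4 (zero_dvd_iff.mp hdv)

lemma aux_bound (n : ℕ) (hn : 2 ≤ n) (x : ℝ) (hx : 0 ≤ x) :
    |(((2 * ⌊x⌋₊) * (2 * ⌊x⌋₊ + 1) ^ n : ℕ) : ℝ) - (2 * x) ^ (n + 1)| ≤
      (2 * 3 ^ n + 2 * n * 3 ^ n) * x ^ n := by
  have h3 : (1 : ℝ) ≤ 3 ^ n := one_le_pow₀ (by norm_num)
  rcases lt_or_ge x 1 with h | h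
  · rw [Nat.floor_eq_zero.mpr h]
    simp only [mul_zero, zero_mul, Nat.cast_zero, zero_sub, abs_neg]
    rw [abs_of_nonneg (by positivity), mul_pow, pow_succ x, pow_succ (2 : ℝ)]
    have h2 : (2 : ℝ) ^ n ≤ 3 ^ n := by gcongr; norm_num
    have hxn : 0 ≤ x ^ n := by positivity
    calc (2 : ℝ) ^ n * 2 * (x ^ n * x) ≤ 3 ^ n * 2 * (x ^ n * 1) := by gcongr
      _ ≤ _ := by
        have : 0 ≤ 2 * (n : ℝ) * 3 ^ n * x ^ n := by positivity
        linarith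
  · have hk1 := Nat.floor_le hx
    have hk2 := Nat.lt_floor_add_one x
    push_cast
    set k : ℝ := (⌊x⌋₊ : ℝ)
    have hk0 : 0 ≤ k := by positivity
    have e : 2 * k * (2 * k + 1) ^ n - (2 * x) ^ (n + 1) =
        (2 * k - 2 * x) * (2 * k + 1) ^ n + 2 * x * ((2 * k + 1) ^ n - (2 * x) ^ n) := by ring
    rw [e]
    have b1 : |(2 * k - 2 * x) * (2 * k + 1) ^ n| ≤ 2 * (3 * x) ^ n := by
      rw [abs_mul, abs_of_nonneg (a := (2 * k + 1) ^ n) (by positivity)]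
      have : |2 * k - 2 * x| ≤ 2 := by rw [abs_le]; constructor <;> linarith
      gcongr
      linarith
    have b2 : |(2 * k + 1) ^ n - (2 * x) ^ n| ≤ 1 * n * (3 * x) ^ (n - 1) := by
      refine (abs_pow_sub_pow_le _ _ _).trans ?_
      have : |2 * k + 1 - 2 * x| ≤ 1 := by rw [abs_le]; constructor <;> linarith
      have hm : max |2 * k + 1| |2 * x| ≤ 3 * x := by
        rw [abs_of_nonneg (by positivity), abs_of_nonneg (by positivity)]
        exact max_le (by linarith) (by linarith)
      gcongr
    have b3 : |2 * x * ((2 * k + 1) ^ n - (2 * x) ^ n)| ≤ 2 * n * (3 * x) ^ n := by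
      rw [abs_mul, abs_of_nonneg (by positivity : 0 ≤ 2 * x)]
      calc _ ≤ 2 * x * (1 * n * (3 * x) ^ (n - 1)) := by gcongr
        _ ≤ 2 * (3 * x) * (1 * n * (3 * x) ^ (n - 1)) := by gcongr; linarith
        _ = _ := by
          obtain ⟨m, rfl⟩ : ∃ m, n = m + 1 := ⟨n - 1, by omega⟩
          rw [Nat.add_sub_cancel, pow_succ (3 * x)]; ring
    calc _ ≤ _ := abs_add_le _ _
      _ ≤ 2 * (3 * x) ^ n + 2 * n * (3 * x) ^ n := add_le_add b1 b3
      _ = _ := by rw [mul_pow]; ring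

lemma aux_natCard (n : ℕ) (H : ℝ) (hH : 0 ≤ H) :
    Nat.card {a : Fin (n + 1) → ℤ //
            (∀ i, (|a i| : ℝ) ≤ H) ∧ a (Fin.last n) ≠ 0 ∧ Finset.univ.gcd a = 1} =
      ((auxBox n ⌊H⌋₊ 1).filter (fun a => Finset.univ.gcd a = 1)).card := by
  rw [← Nat.card_eq_finsetCard]
  refine Nat.card_congr (Equiv.subtypeEquivRight fun a => ?_)
  have key : ∀ x : ℤ, (|(x : ℝ)| ≤ H) ↔ x ∈ Finset.Icc (-(⌊H⌋₊ : ℤ)) ⌊H⌋₊ := by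
    intro x
    rw [Finset.mem_Icc, ← abs_le, Int.natCast_floor_eq_floor hH, Int.le_floor, Int.cast_abs]
  simp only [key, auxBox, Fintype.mem_piFinset, Finset.mem_filter,
    Nat.cast_one, isUnit_one, IsUnit.dvd, true_and]
  constructor
  · rintro ⟨h1, h2, h3⟩
    exact ⟨fun i => ⟨h1 i, fun hi => hi ▸ h2⟩, h3⟩
  · rintro ⟨h1, h3⟩
    exact ⟨fun i => (h1 i).1, (h1 _).2 rfl, h3⟩

/-- The number of `(a_0, …, a_n) ∈ ℤ^{n+1}` with `|a_i| ≤ H`, `a_n ≠ 0` and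
`gcd(a_0, …, a_n) = 1` equals `(2^{n+1}/ζ(n+1))·H^{n+1} + O(Hⁿ)` as `H → ∞`. -/
theorem stmt13 (n : ℕ) (hn : 2 ≤ n) :
    (fun H : ℝ =>
        (Nat.card {a : Fin (n + 1) → ℤ //
            (∀ i, (|a i| : ℝ) ≤ H) ∧ a (Fin.last n) ≠ 0 ∧ Finset.univ.gcd a = 1} : ℝ) -
          (2 ^ (n + 1) / (∑' k : ℕ, 1 / ((k : ℝ) + 1) ^ (n + 1))) * H ^ (n + 1))
      =O[atTop] fun H : ℝ => H ^ n := by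
  have hsn : Summable (fun d : ℕ => 1 / (d : ℝ) ^ n) :=
    Real.summable_one_div_nat_pow.mpr (by omega)
  have hsn1 : Summable (fun d : ℕ => 1 / (d : ℝ) ^ (n + 1)) :=
    Real.summable_one_div_nat_pow.mpr (by omega)
  have hmu : ∀ d : ℕ, |(ArithmeticFunction.moebius d : ℝ)| ≤ 1 := fun d => by
    exact_mod_cast ArithmeticFunction.abs_moebius_le_one (n := d)
  have hsM : Summable (fun d : ℕ => (ArithmeticFunction.moebius d : ℝ) / (d : ℝ) ^ (n + 1)) := by
    refine Summable.of_norm_bounded hsn1 fun d => ?_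
    rw [Real.norm_eq_abs, abs_div, abs_of_nonneg (a := (d : ℝ) ^ (n + 1)) (by positivity)]
    gcongr
    exact hmu d
  have hz := aux_zeta n hn
  set Z := ∑' k : ℕ, 1 / ((k : ℝ) + 1) ^ (n + 1)
  set M := ∑' d : ℕ, (ArithmeticFunction.moebius d : ℝ) / (d : ℝ) ^ (n + 1) with hM
  have hZ0 : Z ≠ 0 := left_ne_zero_of_mul_eq_one hz
  have hZM : 2 ^ (n + 1) / Z = 2 ^ (n + 1) * M := by
    rw [div_eq_iff hZ0, mul_assoc, mul_comm M, hz, mul_one]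
  rw [hZM]
  set C : ℝ := 2 * 3 ^ n + 2 * n * 3 ^ n with hC
  refine Asymptotics.IsBigO.of_bound (C * ∑' d : ℕ, 1 / (d : ℝ) ^ n) ?_
  filter_upwards [eventually_ge_atTop 0] with H hH
  rw [aux_natCard n H hH]
  have hcount := aux_count n ⌊H⌋₊
  set P := ((auxBox n ⌊H⌋₊ 1).filter (fun a => Finset.univ.gcd a = 1)).card
  set F : ℝ → ℝ := fun x => (((2 * ⌊x⌋₊) * (2 * ⌊x⌋₊ + 1) ^ n : ℕ) : ℝ) with hF
  have hP : (P : ℝ) = ∑ d ∈ Finset.range (⌊H⌋₊ + 1),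
      (ArithmeticFunction.moebius d : ℝ) * F (H / d) := by
    have := congrArg (fun z : ℤ => (z : ℝ)) hcount
    simp only [Int.cast_natCast, Int.cast_sum, Int.cast_mul] at this
    rw [this]
    refine Finset.sum_congr rfl fun d _ => ?_
    simp only [hF, Nat.floor_div_natCast]
  have hPs : HasSum (fun d : ℕ => (ArithmeticFunction.moebius d : ℝ) * F (H / d)) (P : ℝ) := by
    rw [hP]
    refine hasSum_sum_of_ne_finset_zero fun d hd => ?_
    have : ⌊H⌋₊ / d = 0 := Nat.div_eq_of_lt (by simpa using hd)
    simp only [hF, Nat.floor_div_natCast, this]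
    simp
  have hMs := (hsM.hasSum).mul_left (2 ^ (n + 1) * H ^ (n + 1))
  have hD := hPs.sub hMs
  have hb : HasSum (fun d : ℕ => C * H ^ n * (1 / (d : ℝ) ^ n))
      (C * H ^ n * ∑' d : ℕ, 1 / (d : ℝ) ^ n) := hsn.hasSum.mul_left _
  have hfin := hD.norm_le_of_bounded hb fun d => by
    have e : (ArithmeticFunction.moebius d : ℝ) * F (H / d) -
        2 ^ (n + 1) * H ^ (n + 1) * ((ArithmeticFunction.moebius d : ℝ) / (d : ℝ) ^ (n + 1)) =
        (ArithmeticFunction.moebius d : ℝ) * (F (H / d) - (2 * (H / d)) ^ (n + 1)) := by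
      rw [mul_pow, div_pow]; ring
    rw [e, Real.norm_eq_abs, abs_mul]
    have hB := aux_bound n hn (H / d) (by positivity)
    calc _ ≤ 1 * (C * (H / d) ^ n) := mul_le_mul (hmu d) hB (abs_nonneg _) (by norm_num)
      _ = _ := by rw [div_pow]; ring
  rw [← hM] at hfin
  rw [Real.norm_eq_abs (H ^ n), abs_of_nonneg (by positivity)]
  calc _ = _ := by congr 1; ring
    _ ≤ _ := hfin
    _ = _ := by ring
end

section
/- For each integer n ≥ 2, there exists a positive constant C_n = (2^{n+1}/ζ(n+1)) · Σ_{k squarefree} k^{−(n+1)} such that the number of tuples (a_0,…,a_n) ∈ Z^{n+1} with |a_i| ≤ H for all i, a_n ≠ 0, and gcd(a_0,…,a_n) squarefree is asymptotic to C_n · H^{n+1} as H → ∞. -/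
open Filter Asymptotics

namespace SqfAux

/-- tuples with entries bounded by `M` and nonzero last entry -/
noncomputable def box (n M : ℕ) : Finset (Fin (n + 1) → ℤ) :=
  (Fintype.piFinset fun _ => Finset.Icc (-(M : ℤ)) M).filter fun a => a (Fin.last n) ≠ 0

/-- the gcd of a tuple as a natural number -/
noncomputable def G {n : ℕ} (a : Fin (n + 1) → ℤ) : ℕ := (Finset.univ.gcd a).natAbs

lemma mem_box {n M : ℕ} {a : Fin (n + 1) → ℤ} :
    a ∈ box n M ↔ (∀ i, |a i| ≤ (M : ℤ)) ∧ a (Fin.last n) ≠ 0 := by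
  simp [box, Fintype.mem_piFinset, abs_le]

lemma dvd_G {n : ℕ} {a : Fin (n + 1) → ℤ} {k : ℕ} : k ∣ G a ↔ ∀ i, (k : ℤ) ∣ a i := by
  rw [G, ← Int.natCast_dvd, Finset.dvd_gcd_iff]
  simp

lemma G_smul {n : ℕ} (b : Fin (n + 1) → ℤ) (k : ℕ) : G (fun i => (k : ℤ) * b i) = k * G b := by
  rw [G, Finset.gcd_mul_left, Int.natAbs_mul, G, ← Int.abs_eq_normalize, Int.natAbs_abs, Int.natAbs_natCast]

lemma G_pos {n M : ℕ} {a : Fin (n + 1) → ℤ} (ha : a ∈ box n M) : 0 < G a := by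
  rw [mem_box] at ha
  rcases Nat.eq_zero_or_pos (G a) with h | h
  · exfalso
    have h2 : 0 ∣ G a := by simp [h]
    have := dvd_G.1 h2 (Fin.last n)
    exact ha.2 (by simpa using this)
  · exact h

lemma G_le {n M : ℕ} {a : Fin (n + 1) → ℤ} (ha : a ∈ box n M) : G a ≤ M := by
  rw [mem_box] at ha
  have h := dvd_G.1 (dvd_refl (G a)) (Fin.last n)
  have h1 := Int.le_of_dvd (abs_pos.2 ha.2) ((dvd_abs _ _).2 h)
  have h2 := ha.1 (Fin.last n)
  exact_mod_cast h1.trans h2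

lemma card_scale (n M k : ℕ) (hk : 0 < k) (P : ℕ → Prop) [DecidablePred P] :
    ((box n M).filter fun a => k ∣ G a ∧ P (G a)).card =
      ((box n (M / k)).filter fun b => P (k * G b)).card := by
  classical
  have hk' : (0 : ℤ) < k := by exact_mod_cast hk
  have hinj : Function.Injective
      (fun (b : Fin (n + 1) → ℤ) => (fun i => (k : ℤ) * b i : Fin (n + 1) → ℤ)) := by
    intro b c h
    funext i
    have := congrFun h i
    exact mul_left_cancel₀ hk'.ne' this
  rw [← Finset.card_image_of_injective ((box n (M / k)).filter fun b => P (k * G b)) hinj]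
  refine congrArg Finset.card ?_
  have key : ∀ b : Fin (n + 1) → ℤ, (fun i => (k : ℤ) * b i : Fin (n + 1) → ℤ) ∈ box n M ↔
      b ∈ box n (M / k) := by
    intro b
    rw [mem_box, mem_box]
    refine and_congr (forall_congr' fun i => ?_) ?_
    · rw [abs_mul, abs_of_pos hk', Int.natCast_div, Int.le_ediv_iff_mul_le hk', mul_comm]
    · simp [hk.ne']
  refine Finset.ext fun a => ?_
  simp only [Finset.mem_filter, Finset.mem_image]
  constructor
  · rintro ⟨ha, hd, hP⟩
    choose b hb using dvd_G.1 hd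
    have hab : a = fun i => (k : ℤ) * b i := funext hb
    subst hab
    refine ⟨b, ⟨(key b).1 ha, ?_⟩, rfl⟩
    rwa [G_smul] at hP
  · rintro ⟨b, ⟨hb, hP⟩, rfl⟩
    refine ⟨(key b).2 hb, ?_, ?_⟩
    · rw [G_smul]; exact dvd_mul_right _ _
    · rwa [G_smul]

lemma card_box (n M : ℕ) : (box n M).card = (2 * M + 1) ^ n * (2 * M) := by
  classical
  have : box n M = Fintype.piFinset (fun i : Fin (n + 1) =>
      if i = Fin.last n then (Finset.Icc (-(M : ℤ)) M).erase 0 else Finset.Icc (-(M : ℤ)) M) := by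
    ext a
    simp only [box, Finset.mem_filter, Fintype.mem_piFinset]
    constructor
    · rintro ⟨h1, h2⟩ i
      split_ifs with h
      · subst h
        exact Finset.mem_erase.2 ⟨h2, h1 _⟩
      · exact h1 i
    · intro h
      have hl := h (Fin.last n)
      simp only [if_true] at hl
      refine ⟨fun i => ?_, (Finset.mem_erase.1 hl).1⟩
      have := h i
      split_ifs at this with h'
      · exact (Finset.mem_erase.1 this).2
      · exact this
  rw [this, Fintype.card_piFinset, Fin.prod_univ_castSucc]
  have h1 : (Finset.Icc (-(M : ℤ)) M).card = 2 * M + 1 := by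
    rw [Int.card_Icc]; omega
  have h2 : ((Finset.Icc (-(M : ℤ)) M).erase 0).card = 2 * M := by
    rw [Finset.card_erase_of_mem (by simp), h1]; omega
  simp [h1, h2, Fin.castSucc_ne_last]

/-- coprime count -/
noncomputable def Z (n M : ℕ) : ℕ := ((box n M).filter fun a => G a = 1).card

lemma Z_eq (n M : ℕ) : (Z n M : ℝ) =
    ∑ k ∈ Finset.range (M + 1), (ArithmeticFunction.moebius k : ℝ) * ((box n (M / k)).card : ℝ) := by
  classical
  have h1 : (Z n M : ℝ) = ∑ a ∈ box n M, ∑ k ∈ Finset.range (M + 1),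
      if k ∣ G a then (ArithmeticFunction.moebius k : ℝ) else 0 := by
    rw [Z, Finset.card_filter]
    push_cast
    refine Finset.sum_congr rfl fun a ha => ?_
    rw [← Finset.sum_filter]
    have : (Finset.range (M + 1)).filter (fun k => k ∣ G a) = (G a).divisors := by
      ext k
      have h3 := G_pos ha
      have h4 := G_le ha
      simp only [Finset.mem_filter, Finset.mem_range, Nat.mem_divisors]
      constructor
      · rintro ⟨_, h⟩; exact ⟨h, h3.ne'⟩
      · rintro ⟨h, _⟩; exact ⟨by have := Nat.le_of_dvd h3 h; omega, h⟩
    rw [this, ← Int.cast_sum, ← ArithmeticFunction.coe_mul_zeta_apply,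
      ArithmeticFunction.moebius_mul_coe_zeta, ArithmeticFunction.one_apply]
    split_ifs <;> simp
  rw [h1, Finset.sum_comm]
  refine Finset.sum_congr rfl fun k _ => ?_
  rcases Nat.eq_zero_or_pos k with rfl | hk
  · simp
  have := card_scale n M k hk (fun _ => True)
  simp only [and_true, Finset.filter_true] at this
  rw [← this, ← Finset.sum_filter, Finset.sum_const, nsmul_eq_mul, mul_comm]

lemma F_eq (n M : ℕ) : (((box n M).filter fun a => Squarefree (G a)).card : ℝ) =
    ∑ k ∈ Finset.range (M + 1), (if Squarefree k then (1 : ℝ) else 0) * (Z n (M / k) : ℝ) := by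
  classical
  rw [Finset.card_filter]
  push_cast
  have h1 : ∀ a ∈ box n M, (if Squarefree (G a) then (1 : ℝ) else 0) =
      ∑ k ∈ Finset.range (M + 1), if G a = k then (if Squarefree k then (1 : ℝ) else 0) else 0 := by
    intro a ha
    rw [Finset.sum_ite_eq, if_pos (Finset.mem_range.2 (Nat.lt_succ_of_le (G_le ha)))]
  rw [Finset.sum_congr rfl h1, Finset.sum_comm]
  refine Finset.sum_congr rfl fun k _ => ?_
  rcases Nat.eq_zero_or_pos k with rfl | hk
  · simp
  have := card_scale n M k hk (fun g => g = k)
  have e1 : ((box n M).filter fun a => k ∣ G a ∧ G a = k) = (box n M).filter fun a => G a = k := by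
    refine Finset.filter_congr fun a _ => ⟨fun h => h.2, fun h => ⟨h ▸ dvd_rfl, h⟩⟩
  have e2 : ((box n (M / k)).filter fun b => k * G b = k) =
      (box n (M / k)).filter fun b => G b = 1 := by
    refine Finset.filter_congr fun a _ => ?_
    simp [hk.ne']
  rw [e1, e2] at this
  rw [Z, ← this, ← Finset.sum_filter, Finset.sum_const, nsmul_eq_mul, mul_comm]

lemma tendsto_div (k : ℕ) :
    Tendsto (fun M : ℕ => ((M / k : ℕ) : ℝ) / (M : ℝ)) atTop (nhds (1 / (k : ℝ))) := by
  have h := (tendsto_nat_floor_mul_div_atTop (R := ℝ) (a := 1 / (k : ℝ)) (by positivity)).comp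
    (tendsto_natCast_atTop_atTop (R := ℝ))
  refine h.congr fun M => ?_
  simp only [Function.comp]
  rw [one_div, inv_mul_eq_div, Nat.floor_div_natCast, Nat.floor_natCast]

lemma main_lim (d : ℕ) (hd : 2 ≤ d) (h : ℕ → ℝ) (L B : ℝ) (w : ℕ → ℝ)
    (hL : Tendsto (fun M : ℕ => h M / (M : ℝ) ^ d) atTop (nhds L))
    (hB : ∀ M, |h M| ≤ B * (M : ℝ) ^ d) (hw : ∀ k, |w k| ≤ 1) :
    Tendsto (fun M : ℕ => (∑ k ∈ Finset.range (M + 1), w k * h (M / k)) / (M : ℝ) ^ d) atTop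
      (nhds (∑' k : ℕ, w k * (L * (1 / (k : ℝ)) ^ d))) := by
  have h0 : h 0 = 0 := by
    have := hB 0
    simpa [show d ≠ 0 by omega] using this
  have hB0 : 0 ≤ B := by simpa using (abs_nonneg _).trans (hB 1)
  have e : ∀ M : ℕ, (∑ k ∈ Finset.range (M + 1), w k * h (M / k)) / (M : ℝ) ^ d =
      ∑' k : ℕ, w k * (h (M / k) / (M : ℝ) ^ d) := by
    intro M
    rw [tsum_eq_sum (s := Finset.range (M + 1)), Finset.sum_div]
    · exact Finset.sum_congr rfl fun k _ => by rw [mul_div_assoc]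
    · intro k hk
      have : M / k = 0 := Nat.div_eq_of_lt (by simpa using hk)
      simp [this, h0]
  simp only [e]
  refine tendsto_tsum_of_dominated_convergence (bound := fun k : ℕ => B * (1 / (k : ℝ)) ^ d) ?_ ?_ ?_
  · refine Summable.mul_left _ ?_
    simpa using (Real.summable_nat_pow_inv (p := d)).2 (by omega)
  · intro k
    refine Tendsto.const_mul _ ?_
    rcases Nat.eq_zero_or_pos k with rfl | hk
    · simp [h0, show d ≠ 0 by omega]
    have h1 : Tendsto (fun M : ℕ => M / k) atTop atTop := Nat.tendsto_div_const_atTop hk.ne'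
    have h2 := (hL.comp h1).mul ((tendsto_div k).pow d)
    refine h2.congr fun M => ?_
    simp only [Function.comp]
    rcases Nat.eq_zero_or_pos (M / k) with hz | hp
    · rw [hz, h0]; simp
    · have : ((M / k : ℕ) : ℝ) ≠ 0 := by exact_mod_cast hp.ne'
      rw [div_pow]
      field_simp
  · filter_upwards [eventually_gt_atTop 0] with M hM k
    rw [norm_mul, Real.norm_eq_abs, Real.norm_eq_abs, abs_div]
    have hMp : (0 : ℝ) < (M : ℝ) := by exact_mod_cast hM
    have hMd : (0 : ℝ) < (M : ℝ) ^ d := by positivity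
    rw [abs_of_pos hMd]
    have h3 : |h (M / k)| / (M : ℝ) ^ d ≤ B * (1 / (k : ℝ)) ^ d := by
      rw [div_le_iff₀ hMd, mul_assoc, ← mul_pow]
      refine (hB _).trans ?_
      have : ((M / k : ℕ) : ℝ) ≤ 1 / (k : ℝ) * M := by
        rw [one_div, inv_mul_eq_div]; exact Nat.cast_div_le
      gcongr
    calc |w k| * (|h (M / k)| / (M : ℝ) ^ d) ≤ 1 * (|h (M / k)| / (M : ℝ) ^ d) := by
          gcongr; exact hw k
      _ ≤ _ := by rw [one_mul]; exact h3

lemma card_box_le (n M : ℕ) : |((box n M).card : ℝ)| ≤ 3 ^ (n + 1) * (M : ℝ) ^ (n + 1) := by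
  rw [Nat.abs_cast, ← mul_pow, card_box]
  norm_cast
  rcases Nat.eq_zero_or_pos M with rfl | hM
  · simp
  rw [pow_succ]
  gcongr <;> omega

lemma Z_le (n M : ℕ) : |(Z n M : ℝ)| ≤ 3 ^ (n + 1) * (M : ℝ) ^ (n + 1) := by
  refine le_trans ?_ (card_box_le n M)
  rw [Nat.abs_cast, Nat.abs_cast]
  exact_mod_cast Finset.card_filter_le _ _

lemma box_lim (n : ℕ) : Tendsto (fun M : ℕ => ((box n M).card : ℝ) / (M : ℝ) ^ (n + 1)) atTop
    (nhds (2 ^ (n + 1))) := by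
  have h1 : Tendsto (fun M : ℕ => 2 + 1 / (M : ℝ)) atTop (nhds (2 + 0)) :=
    tendsto_const_nhds.add tendsto_one_div_atTop_nhds_zero_nat
  have h2 := (h1.pow n).mul_const 2
  rw [add_zero, ← pow_succ] at h2
  refine h2.congr' ?_
  filter_upwards [eventually_gt_atTop 0] with M hM
  have : (M : ℝ) ≠ 0 := by exact_mod_cast hM.ne'
  rw [card_box]
  push_cast
  have e : (2 + 1 / (M : ℝ)) = (2 * M + 1) / M := by field_simp
  rw [e, div_pow, pow_succ]
  field_simp

lemma moebius_sum (d : ℕ) (hd : 2 ≤ d) :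
    (∑' k : ℕ, (ArithmeticFunction.moebius k : ℝ) * (1 / (k : ℝ)) ^ d) =
      (∑' k : ℕ, 1 / ((k : ℝ) + 1) ^ d)⁻¹ := by
  have hs : 1 < (d : ℂ).re := by simp; omega
  have h := ArithmeticFunction.LSeries_zeta_mul_Lseries_moebius hs
  rw [ArithmeticFunction.LSeries_zeta_eq_riemannZeta hs,
    zeta_eq_tsum_one_div_nat_add_one_cpow hs] at h
  have e1 : (∑' k : ℕ, 1 / ((k : ℂ) + 1) ^ (d : ℂ)) =
      ((∑' k : ℕ, 1 / ((k : ℝ) + 1) ^ d : ℝ) : ℂ) := by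
    push_cast
    simp only [Complex.cpow_natCast]
  have e2 : LSeries (fun n => ((ArithmeticFunction.moebius n : ℤ) : ℂ)) (d : ℂ) =
      ((∑' k : ℕ, (ArithmeticFunction.moebius k : ℝ) * (1 / (k : ℝ)) ^ d : ℝ) : ℂ) := by
    push_cast
    refine tsum_congr fun k => ?_
    rcases Nat.eq_zero_or_pos k with rfl | hk
    · simp
    rw [LSeries.term_of_ne_zero hk.ne', Complex.cpow_natCast]
    simp [div_eq_mul_inv]
  rw [e1, e2] at h
  exact eq_inv_of_mul_eq_one_right (by exact_mod_cast h)

lemma card_eq (n : ℕ) (H : ℝ) (hH : 0 ≤ H) :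
    Nat.card {a : Fin (n + 1) → ℤ //
            (∀ i, (|a i| : ℝ) ≤ H) ∧ a (Fin.last n) ≠ 0 ∧
              Squarefree (Finset.univ.gcd a)} =
      ((box n ⌊H⌋₊).filter fun a => Squarefree (G a)).card := by
  classical
  rw [← Nat.card_eq_finsetCard]
  refine Nat.card_congr (Equiv.subtypeEquivRight fun a => ?_)
  rw [Finset.mem_filter, mem_box, and_assoc, G, Int.squarefree_natAbs]
  refine and_congr (forall_congr' fun i => ?_) Iff.rfl
  rw [← Int.natCast_natAbs, Nat.cast_le, Nat.le_floor_iff hH, Nat.cast_natAbs, Int.cast_abs]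

end SqfAux

open SqfAux in
/-- The number of `(a_0, …, a_n) ∈ ℤ^{n+1}` with `|a_i| ≤ H`, `a_n ≠ 0` and
`gcd(a_0, …, a_n)` squarefree is asymptotic to `C_n·H^{n+1}` as `H → ∞`, where
`C_n = (2^{n+1}/ζ(n+1))·Σ_{k squarefree} k^{-(n+1)} > 0`. -/
theorem stmt14 (n : ℕ) (hn : 2 ≤ n) :
    letI C : ℝ := (2 ^ (n + 1) / (∑' k : ℕ, 1 / ((k : ℝ) + 1) ^ (n + 1))) *
      ∑' k : ℕ, if Squarefree k then 1 / (k : ℝ) ^ (n + 1) else 0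
    0 < C ∧
    (fun H : ℝ =>
        (Nat.card {a : Fin (n + 1) → ℤ //
            (∀ i, (|a i| : ℝ) ≤ H) ∧ a (Fin.last n) ≠ 0 ∧
              Squarefree (Finset.univ.gcd a)} : ℝ))
      ~[atTop] fun H : ℝ => C * H ^ (n + 1) := by

  have hd : 2 ≤ n + 1 := by omega
  have hzs : Summable (fun k : ℕ => 1 / ((k : ℝ) + 1) ^ (n + 1)) := by
    have := (summable_nat_add_iff 1).2 ((Real.summable_one_div_nat_pow (p := n + 1)).2 (by omega))
    simpa using this
  have hzpos : 0 < ∑' k : ℕ, 1 / ((k : ℝ) + 1) ^ (n + 1) :=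
    hzs.tsum_pos (fun k => by positivity) 0 (by positivity)
  have hnn : ∀ k : ℕ, (0 : ℝ) ≤ if Squarefree k then 1 / (k : ℝ) ^ (n + 1) else 0 := by
    intro k; split_ifs <;> positivity
  have hss : Summable (fun k : ℕ => if Squarefree k then 1 / (k : ℝ) ^ (n + 1) else 0) := by
    refine Summable.of_nonneg_of_le hnn (fun k => ?_)
      ((Real.summable_one_div_nat_pow (p := n + 1)).2 (by omega))
    split_ifs
    · exact le_rfl
    · positivity
  have hspos : 0 < ∑' k : ℕ, if Squarefree k then 1 / (k : ℝ) ^ (n + 1) else 0 :=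
    hss.tsum_pos hnn 1 (by simp)
  have hC : 0 < (2 ^ (n + 1) / (∑' k : ℕ, 1 / ((k : ℝ) + 1) ^ (n + 1))) *
      ∑' k : ℕ, if Squarefree k then 1 / (k : ℝ) ^ (n + 1) else 0 := by positivity
  refine ⟨hC, ?_⟩
  have hZ : Tendsto (fun M : ℕ => (Z n M : ℝ) / (M : ℝ) ^ (n + 1)) atTop
      (nhds (2 ^ (n + 1) / (∑' k : ℕ, 1 / ((k : ℝ) + 1) ^ (n + 1)))) := by
    have h := main_lim (n + 1) hd (fun M => ((box n M).card : ℝ)) (2 ^ (n + 1)) (3 ^ (n + 1))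
      (fun k => (ArithmeticFunction.moebius k : ℝ)) (box_lim n) (card_box_le n)
      (fun k => by exact_mod_cast ArithmeticFunction.abs_moebius_le_one)
    simp only [← Z_eq] at h
    convert h using 2
    rw [div_eq_mul_inv, ← moebius_sum (n + 1) hd, ← tsum_mul_left]
    exact tsum_congr fun k => by ring
  have hF := main_lim (n + 1) hd (fun M => (Z n M : ℝ)) _ (3 ^ (n + 1))
      (fun k => if Squarefree k then (1 : ℝ) else 0) hZ (Z_le n)
      (fun k => by split_ifs <;> simp)
  simp only [← F_eq] at hF
  have eC : (∑' k : ℕ, (if Squarefree k then (1 : ℝ) else 0) *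
      (2 ^ (n + 1) / (∑' k : ℕ, 1 / ((k : ℝ) + 1) ^ (n + 1)) * (1 / (k : ℝ)) ^ (n + 1))) =
      (2 ^ (n + 1) / (∑' k : ℕ, 1 / ((k : ℝ) + 1) ^ (n + 1))) *
      ∑' k : ℕ, if Squarefree k then 1 / (k : ℝ) ^ (n + 1) else 0 := by
    rw [← tsum_mul_left]
    refine tsum_congr fun k => ?_
    split_ifs <;> simp
  rw [eC] at hF
  generalize (2 ^ (n + 1) / (∑' k : ℕ, 1 / ((k : ℝ) + 1) ^ (n + 1))) *
      (∑' k : ℕ, if Squarefree k then 1 / (k : ℝ) ^ (n + 1) else 0) = C at hC hF ⊢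
  have h1 := (hF.comp (tendsto_nat_floor_atTop (α := ℝ))).mul
    ((tendsto_nat_floor_div_atTop (R := ℝ)).pow (n + 1))
  rw [one_pow, mul_one] at h1
  have hne : ∀ᶠ H : ℝ in atTop, C * H ^ (n + 1) ≠ 0 := by
    filter_upwards [eventually_gt_atTop 0] with H hH
    positivity
  rw [isEquivalent_iff_tendsto_one hne]
  have h2 := h1.div_const C
  rw [div_self hC.ne'] at h2
  refine h2.congr' ?_
  filter_upwards [eventually_ge_atTop 1] with H hH
  have hf : ((⌊H⌋₊ : ℕ) : ℝ) ≠ 0 := by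
    have := (Nat.floor_pos).2 hH
    exact_mod_cast this.ne'
  have hH0 : H ≠ 0 := by positivity
  simp only [Function.comp, Pi.div_apply]
  rw [card_eq n H (by positivity), div_pow]
  field_simp
end

section
/- Let F be a number field, n ≥ 2, N a positive multiple of n, and P(T) ∈ O_F[T] of degree N, separable, with no root in F, and assume N = 4 and n = 2 divides N. Then the Galois group of P(T) over F contains an element fixing no root of P(T). Consequently, the hyperelliptic curve Y² = P(T,Z) has a twist Y² = d·P(T,Z) with no F-rational point for some non-square d ∈ O_F \ {0}. -/
open NumberField Polynomial

/-- The sum over finitely supported exponent vectors of the corresponding monomials. -/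
noncomputable def eulerW {ι : Type*} (x : ι → ENNReal) : ENNReal :=
  ∑' f : ι →₀ ℕ, f.prod fun i n => x i ^ n

lemma eulerW_sum {ι κ : Type*} (x : ι ⊕ κ → ENNReal) :
    eulerW x = eulerW (x ∘ Sum.inl) * eulerW (x ∘ Sum.inr) := by
  unfold eulerW
  rw [← Finsupp.sumFinsuppEquivProdFinsupp.symm.tsum_eq, ENNReal.tsum_prod']
  simp only [Finsupp.sumFinsuppEquivProdFinsupp_symm_apply, Finsupp.prod_sumElim]
  simp only [Function.comp_def, ENNReal.tsum_mul_left, ENNReal.tsum_mul_right]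

lemma eulerW_le {ι κ : Type*} (x : ι → ENNReal) (y : κ → ENNReal) (e : ι ↪ κ)
    (h : ∀ i, x i ≤ y (e i)) : eulerW x ≤ eulerW y := by
  unfold eulerW
  calc ∑' f : ι →₀ ℕ, (f.prod fun i n => x i ^ n)
      ≤ ∑' f : ι →₀ ℕ, ((f.embDomain e).prod fun i n => y i ^ n) := by
        refine ENNReal.tsum_le_tsum fun f => ?_
        rw [Finsupp.prod_embDomain]
        exact Finset.prod_le_prod' fun i _ => pow_le_pow_left' (h i) _
    _ ≤ _ := ENNReal.tsum_comp_le_tsum_of_injective (Finsupp.embDomain_injective e)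
        (fun f : κ →₀ ℕ => f.prod fun i n => y i ^ n)

lemma eulerW_lt_top {ι : Type*} [Finite ι] (c : ENNReal) (hc : c < 1) :
    eulerW (fun _ : ι => c) < ⊤ := by
  have key : ∀ (n : ℕ), eulerW (fun _ : Fin n => c) < ⊤ := by
    intro n
    induction n with
    | zero => simp [eulerW]
    | succ n ih =>
      have h1 : eulerW (fun _ : Fin (n+1) => c) ≤ eulerW (fun _ : Fin n ⊕ Fin 1 => c) :=
        eulerW_le _ _ finSumFinEquiv.symm.toEmbedding (fun _ => le_rfl)
      refine h1.trans_lt ?_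
      rw [eulerW_sum]
      refine ENNReal.mul_lt_top ih ?_
      unfold eulerW
      rw [← (Finsupp.uniqueEquiv (M := ℕ) (0 : Fin 1)).symm.tsum_eq]
      have : ∀ m : ℕ, (((Finsupp.uniqueEquiv (M := ℕ) (0 : Fin 1)).symm m).prod
        fun i k => ((fun _ : Fin n ⊕ Fin 1 => c) ∘ Sum.inr) i ^ k) = c ^ m := by
        intro m
        rw [Finsupp.prod_fintype _ _ (by simp)]
        simp
      simp_rw [this]
      rw [ENNReal.tsum_geometric]
      simpa using hc
  obtain ⟨n, ⟨e⟩⟩ := Finite.exists_equiv_fin ι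
  exact (eulerW_le _ _ e.toEmbedding (fun _ => le_rfl)).trans_lt (key n)


open IsDedekindDomain

/-- The nonzero ideal with given exponents. -/
noncomputable def idealOf (K : Type*) [Field K] [NumberField K]
    (f : HeightOneSpectrum (𝓞 K) →₀ ℕ) : Ideal (𝓞 K) :=
  f.prod fun v n => v.asIdeal ^ n

lemma idealOf_eq (K : Type*) [Field K] [NumberField K]
    (f : HeightOneSpectrum (𝓞 K) →₀ ℕ) :
    idealOf K f = (f.toMultiset.map HeightOneSpectrum.asIdeal).prod := by
  rw [Finsupp.toMultiset_map, Finsupp.prod_toMultiset, idealOf, Finsupp.prod_mapDomain_index_inj]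
  exact fun a b h => HeightOneSpectrum.ext h

lemma idealOf_injective (K : Type*) [Field K] [NumberField K] :
    Function.Injective (idealOf K) := by
  intro f g h
  rw [idealOf_eq, idealOf_eq] at h
  have h2 := congrArg UniqueFactorizationMonoid.normalizedFactors h
  rw [UniqueFactorizationMonoid.normalizedFactors_prod_of_prime,
    UniqueFactorizationMonoid.normalizedFactors_prod_of_prime] at h2
  · have h3 := Multiset.map_injective (fun a b h => HeightOneSpectrum.ext h) h2
    classical
    simpa using congrArg Multiset.toFinsupp h3
  · intro p hp
    obtain ⟨v, _, rfl⟩ := Multiset.mem_map.1 hp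
    exact v.prime
  · intro p hp
    obtain ⟨v, _, rfl⟩ := Multiset.mem_map.1 hp
    exact v.prime

lemma idealOf_surj (K : Type*) [Field K] [NumberField K] (I : Ideal (𝓞 K)) (hI : I ≠ ⊥) :
    ∃ f, idealOf K f = I := by
  classical
  have h := Ideal.prod_normalizedFactors_eq_self hI
  have h2 : ∃ m : Multiset (HeightOneSpectrum (𝓞 K)),
      m.map HeightOneSpectrum.asIdeal = UniqueFactorizationMonoid.normalizedFactors I := by
    have inst : CanLift (Ideal (𝓞 K)) (HeightOneSpectrum (𝓞 K)) HeightOneSpectrum.asIdeal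
        (fun J => Prime J) := ⟨fun J hJ => ⟨⟨J, Ideal.isPrime_of_prime hJ, hJ.ne_zero⟩, rfl⟩⟩
    exact (Multiset.canLift HeightOneSpectrum.asIdeal (fun J => Prime J)).prf _
      (fun J hJ => UniqueFactorizationMonoid.prime_of_normalized_factor J hJ)
  obtain ⟨m, hm⟩ := h2
  refine ⟨Multiset.toFinsupp m, ?_⟩
  rw [idealOf_eq, Multiset.toFinsupp_toMultiset, hm, h]

/-- The local Dirichlet weight of a prime. -/
noncomputable def primeWt (K : Type*) [Field K] [NumberField K] (s : ℝ)
    (v : HeightOneSpectrum (𝓞 K)) : ENNReal :=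
  ENNReal.ofReal ((Ideal.absNorm v.asIdeal : ℝ) ^ (-s))

/-- The Dirichlet weight of a natural number. -/
noncomputable def natWt (s : ℝ) (n : ℕ) : ENNReal :=
  if n = 0 then 0 else ENNReal.ofReal ((n : ℝ) ^ (-s))

lemma natWt_mul (s : ℝ) (m n : ℕ) : natWt s (m * n) = natWt s m * natWt s n := by
  unfold natWt
  by_cases hm : m = 0
  · simp [hm]
  by_cases hn : n = 0
  · simp [hn]
  simp only [hm, hn, mul_eq_zero, or_self, if_false]
  rw [← ENNReal.ofReal_mul (by positivity), Nat.cast_mul, Real.mul_rpow (by positivity) (by positivity)]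

/-- `natWt` as a monoid hom. -/
noncomputable def natWtHom (s : ℝ) : ℕ →* ENNReal where
  toFun := natWt s
  map_one' := by simp [natWt]
  map_mul' := natWt_mul s

lemma primeWt_eq (K : Type*) [Field K] [NumberField K] (s : ℝ)
    (v : HeightOneSpectrum (𝓞 K)) : primeWt K s v = natWtHom s (Ideal.absNorm v.asIdeal) := by
  have : Ideal.absNorm v.asIdeal ≠ 0 := by
    rw [Ne, Ideal.absNorm_eq_zero_iff]; exact v.ne_bot
  simp [primeWt, natWtHom, natWt, this]

lemma eulerW_eq (K : Type*) [Field K] [NumberField K] (s : ℝ) :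
    eulerW (primeWt K s) =
      ∑' n : ℕ, (Nat.card {I : Ideal (𝓞 K) // Ideal.absNorm I = n} : ENNReal) * natWt s n := by
  have h1 : ∀ f : HeightOneSpectrum (𝓞 K) →₀ ℕ, (f.prod fun i n => primeWt K s i ^ n) =
      natWt s (Ideal.absNorm (idealOf K f)) := by
    intro f
    change _ = ((natWtHom s).comp (Ideal.absNorm : Ideal (𝓞 K) →*₀ ℕ).toMonoidHom) (idealOf K f)
    rw [idealOf, map_finsuppProd]
    refine Finsupp.prod_congr fun v _ => ?_
    rw [primeWt_eq, map_pow]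
    rfl
  unfold eulerW
  simp_rw [h1]
  rw [(idealOf_injective K).tsum_eq (f := fun I => natWt s (Ideal.absNorm I))]
  · rw [← ENNReal.tsum_fiberwise _ (fun I : Ideal (𝓞 K) => Ideal.absNorm I)]
    refine tsum_congr fun n => ?_
    have hfin : Finite {I : Ideal (𝓞 K) // Ideal.absNorm I = n} :=
      Ideal.finite_setOfPred_absNorm_eq n
    trans ∑' b : {I : Ideal (𝓞 K) // Ideal.absNorm I = n}, natWt s n
    · refine tsum_congr fun b => ?_
      have := b.2
      simp only [Set.mem_preimage, Set.mem_singleton_iff] at this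
      rw [this]
    · rw [ENNReal.tsum_const, ENat.card_eq_coe_natCard]
      simp
  · intro I hI
    by_cases h0 : I = ⊥
    · simp [h0, natWt] at hI
    · exact idealOf_surj K I h0

lemma zeta_eq (K : Type*) [Field K] [NumberField K] (s : ℝ)
    (h : dedekindZeta K s ≠ 0) : dedekindZeta K s = ((eulerW (primeWt K s)).toReal : ℂ) ∧
      eulerW (primeWt K s) ≠ ⊤ := by
  set a : ℕ → ℝ := fun n => if n = 0 then 0 else
    (Nat.card {I : Ideal (𝓞 K) // Ideal.absNorm I = n} : ℝ) * (n : ℝ) ^ (-s) with ha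
  have hterm : LSeries.term (fun n ↦ (Nat.card {I : Ideal (𝓞 K) // Ideal.absNorm I = n} : ℂ)) s =
      fun n => ((a n : ℝ) : ℂ) := by
    funext n
    rw [LSeries.term_def, ha]
    by_cases hn : n = 0
    · simp [hn]
    · simp only [hn, if_false]
      push_cast
      rw [Complex.ofReal_cpow (by positivity), div_eq_mul_inv]
      push_cast
      rw [Complex.cpow_neg]
  have ha0 : ∀ n, 0 ≤ a n := by
    intro n; simp only [ha]; split_ifs <;> positivity
  have hz : dedekindZeta K s = ((∑' n, a n : ℝ) : ℂ) := by
    rw [dedekindZeta, LSeries, hterm, Complex.ofReal_tsum]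
  have hsum : Summable a := by
    by_contra hcon
    rw [hz, tsum_eq_zero_of_not_summable hcon] at h
    simp at h
  have hE : eulerW (primeWt K s) = ENNReal.ofReal (∑' n, a n) := by
    rw [eulerW_eq, ENNReal.ofReal_tsum_of_nonneg ha0 hsum]
    refine tsum_congr fun n => ?_
    simp only [ha, natWt]
    split_ifs with hn
    · simp
    · rw [ENNReal.ofReal_mul (by positivity), ENNReal.ofReal_natCast]
  rw [hE, ENNReal.toReal_ofReal (tsum_nonneg ha0)]
  exact ⟨hz, ENNReal.ofReal_ne_top⟩


lemma primeWt_le (K : Type*) [Field K] [NumberField K] (s : ℝ) (hs : 1 < s)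
    (v : HeightOneSpectrum (𝓞 K)) : primeWt K s v ≤ 2⁻¹ := by
  have h0 : Ideal.absNorm v.asIdeal ≠ 0 := by
    rw [Ne, Ideal.absNorm_eq_zero_iff]; exact v.ne_bot
  have h1 : Ideal.absNorm v.asIdeal ≠ 1 := by
    rw [Ne, Ideal.absNorm_eq_one_iff]; exact v.isPrime.ne_top
  have h2 : (2 : ℝ) ≤ Ideal.absNorm v.asIdeal := by
    have : 2 ≤ Ideal.absNorm v.asIdeal := by omega
    exact_mod_cast this
  have h3 : (Ideal.absNorm v.asIdeal : ℝ) ^ (-s) ≤ 2⁻¹ := by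
    calc (Ideal.absNorm v.asIdeal : ℝ) ^ (-s) ≤ (Ideal.absNorm v.asIdeal : ℝ) ^ (-1 : ℝ) :=
          Real.rpow_le_rpow_of_exponent_le (by linarith) (by linarith)
      _ = (Ideal.absNorm v.asIdeal : ℝ)⁻¹ := Real.rpow_neg_one _
      _ ≤ 2⁻¹ := by gcongr
  calc primeWt K s v ≤ ENNReal.ofReal 2⁻¹ := ENNReal.ofReal_le_ofReal h3
    _ = 2⁻¹ := by rw [ENNReal.ofReal_inv_of_pos (by norm_num)]; simp

open Filter Topology in
lemma zeta_tendsto (K : Type*) [Field K] [NumberField K] :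
    (∀ᶠ s : ℝ in 𝓝[>] 1, eulerW (primeWt K s) ≠ ⊤) ∧
    Tendsto (fun s : ℝ => (s - 1) * (eulerW (primeWt K s)).toReal) (𝓝[>] 1)
      (𝓝 (dedekindZeta_residue K)) := by
  have h := tendsto_sub_one_mul_dedekindZeta_nhdsGT K
  have hne : ∀ᶠ s : ℝ in 𝓝[>] 1, dedekindZeta K s ≠ 0 := by
    have hx : ((dedekindZeta_residue K : ℝ) : ℂ) ≠ 0 := by
      exact_mod_cast dedekindZeta_residue_ne_zero K
    have := h.eventually (isOpen_ne.mem_nhds hx)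
    filter_upwards [this] with s hs
    exact right_ne_zero_of_mul hs
  refine ⟨by filter_upwards [hne] with s hs using (zeta_eq K s hs).2, ?_⟩
  have h' : Tendsto (fun s : ℝ => (((s - 1) * (eulerW (primeWt K s)).toReal : ℝ) : ℂ)) (𝓝[>] 1)
      (𝓝 ((dedekindZeta_residue K : ℝ) : ℂ)) := by
    refine h.congr' ?_
    filter_upwards [hne] with s hs
    rw [(zeta_eq K s hs).1]
    push_cast
    rfl
  have := (Complex.continuous_re.tendsto _).comp h'
  simpa [Function.comp_def] using this

open Filter Topology in
/-- If all but finitely many primes of `E` had two distinct primes of the same norm attached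
injectively in `L`, we get a contradiction. -/
lemma infinite_of_pairs (E L : Type*) [Field E] [NumberField E] [Field L] [NumberField L]
    (S : Set (HeightOneSpectrum (𝓞 E)))
    (e : (Sᶜ : Set (HeightOneSpectrum (𝓞 E))) ⊕ (Sᶜ : Set (HeightOneSpectrum (𝓞 E))) ↪
      HeightOneSpectrum (𝓞 L))
    (h1 : ∀ v, Ideal.absNorm (e (Sum.inl v)).asIdeal = Ideal.absNorm v.1.asIdeal)
    (h2 : ∀ v, Ideal.absNorm (e (Sum.inr v)).asIdeal = Ideal.absNorm v.1.asIdeal) :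
    S.Infinite := by
  classical
  intro hfin
  have : Finite S := hfin
  set C := eulerW (fun _ : S => (2⁻¹ : ENNReal)) with hC
  have hCtop : C < ⊤ := eulerW_lt_top _ (by simp)
  have key : ∀ s : ℝ, 1 < s →
      eulerW (primeWt E s) ^ 2 ≤ C ^ 2 * eulerW (primeWt L s) := by
    intro s hs
    have hE : eulerW (primeWt E s) ≤ C * eulerW (fun v : (Sᶜ : Set _) => primeWt E s v.1) := by
      have a1 : eulerW (primeWt E s) ≤ eulerW (fun v : S ⊕ (Sᶜ : Set _) =>
          primeWt E s (Equiv.Set.sumCompl S v)) :=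
        eulerW_le _ _ (Equiv.Set.sumCompl S).symm.toEmbedding (fun v => by simp)
      refine a1.trans ?_
      rw [eulerW_sum]
      gcongr
      · exact eulerW_le _ _ (Function.Embedding.refl _) (fun v => primeWt_le E s hs _)
      · exact eulerW_le _ _ (Function.Embedding.refl _) (fun v => by simp)
    have hL : eulerW (fun v : (Sᶜ : Set _) => primeWt E s v.1) ^ 2 ≤ eulerW (primeWt L s) := by
      have a1 := eulerW_le (fun v : (Sᶜ : Set (HeightOneSpectrum (𝓞 E))) ⊕
          (Sᶜ : Set (HeightOneSpectrum (𝓞 E))) =>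
            Sum.elim (fun v => primeWt E s v.1) (fun v => primeWt E s v.1) v) (primeWt L s) e (by
        rintro (v | v)
        · simp only [Sum.elim_inl, primeWt, h1]; exact le_rfl
        · simp only [Sum.elim_inr, primeWt, h2]; exact le_rfl)
      rw [eulerW_sum] at a1
      rw [sq]
      exact a1
    calc eulerW (primeWt E s) ^ 2 ≤ (C * eulerW (fun v : (Sᶜ : Set _) => primeWt E s v.1)) ^ 2 := by
          gcongr
      _ ≤ _ := by rw [mul_pow]; gcongr
  obtain ⟨hE1, hE2⟩ := zeta_tendsto E
  obtain ⟨hL1, hL2⟩ := zeta_tendsto L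
  have hs1 : Tendsto (fun s : ℝ => s - 1) (𝓝[>] 1) (𝓝 0) := by
    have : Tendsto (fun s : ℝ => s - 1) (𝓝 1) (𝓝 (1 - 1)) := tendsto_id.sub_const 1
    rw [sub_self] at this
    exact this.mono_left nhdsWithin_le_nhds
  have lim1 := hE2.pow 2
  have lim2 := (hs1.mul hL2).const_mul (C.toReal ^ 2)
  have hle := le_of_tendsto_of_tendsto lim1 lim2 (by
    filter_upwards [hE1, hL1, self_mem_nhdsWithin] with s hs hs' hs''
    have hs'' : 1 < s := hs''
    have k := ENNReal.toReal_mono (ENNReal.mul_ne_top (ENNReal.pow_ne_top hCtop.ne) hs') (key s hs'')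
    rw [ENNReal.toReal_pow, ENNReal.toReal_mul, ENNReal.toReal_pow] at k
    have := mul_le_mul_of_nonneg_left k (sq_nonneg (s - 1))
    calc _ = (s - 1) ^ 2 * (eulerW (primeWt E s)).toReal ^ 2 := by ring
      _ ≤ _ := this
      _ = _ := by ring)
  have := dedekindZeta_residue_pos E
  simp only [zero_mul, mul_zero] at hle
  nlinarith [pow_pos this 2]

open Pointwise in
lemma exists_nonsplit (E L : Type*) [Field E] [NumberField E] [Field L] [NumberField L]
    [Algebra E L] [IsGalois E L] (h2 : Module.finrank E L = 2) (a : 𝓞 L) (ha : a ≠ 0) :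
    ∃ Q : HeightOneSpectrum (𝓞 L), a ∉ Q.asIdeal ∧
      ∀ σ : Gal(L/E), σ • Q.asIdeal = Q.asIdeal := by
  classical
  have hG : IsGaloisGroup Gal(L/E) (𝓞 E) (𝓞 L) := inferInstance
  have hcard : Nat.card Gal(L/E) = 2 := by rw [IsGalois.card_aut_eq_finrank, h2]
  let S : Set (HeightOneSpectrum (𝓞 E)) :=
    {q | ∃ Q : HeightOneSpectrum (𝓞 L), Q.asIdeal.LiesOver q.asIdeal ∧
      ∀ σ : Gal(L/E), σ • Q.asIdeal = Q.asIdeal}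
  have hS : S.Infinite := by
    have hex : ∀ q : (Sᶜ : Set (HeightOneSpectrum (𝓞 E))), ∃ Q₁ Q₂ : HeightOneSpectrum (𝓞 L),
        Q₁.asIdeal.LiesOver q.1.asIdeal ∧ Q₂.asIdeal.LiesOver q.1.asIdeal ∧ Q₁ ≠ Q₂ ∧
        Ideal.absNorm Q₁.asIdeal = Ideal.absNorm q.1.asIdeal ∧
        Ideal.absNorm Q₂.asIdeal = Ideal.absNorm q.1.asIdeal := by
      rintro ⟨q, hq⟩
      have hqp := q.isPrime
      obtain ⟨⟨Q, hQp, hQl⟩⟩ := (inferInstance : Nonempty (q.asIdeal.primesOver (𝓞 L)))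
      have hQ0 : Q ≠ ⊥ := Ideal.ne_bot_of_liesOver_of_ne_bot q.ne_bot Q
      have hσ : ∃ σ : Gal(L/E), σ • Q ≠ Q := by
        by_contra hcon
        push Not at hcon
        exact hq ⟨⟨Q, hQp, hQ0⟩, hQl, hcon⟩
      obtain ⟨σ, hσ⟩ := hσ
      have hRp : (σ • Q).IsPrime := inferInstance
      have hRl : (σ • Q).LiesOver q.asIdeal := inferInstance
      have hR0 : σ • Q ≠ ⊥ := Ideal.ne_bot_of_liesOver_of_ne_bot q.ne_bot _
      have hid := Ideal.ncard_primesOver_mul_ramificationIdxIn_mul_inertiaDegIn q.asIdeal (𝓞 L)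
        Gal(L/E)
      rw [hcard] at hid
      have hfin : (q.asIdeal.primesOver (𝓞 L)).Finite := IsDedekindDomain.primesOver_finite _ _
      have hge : 1 < (q.asIdeal.primesOver (𝓞 L)).ncard := by
        rw [Set.one_lt_ncard hfin]
        exact ⟨Q, ⟨hQp, hQl⟩, σ • Q, ⟨hRp, hRl⟩, hσ.symm⟩
      have hf : Ideal.inertiaDegIn q.asIdeal (𝓞 L) = 1 := by
        have h0 : Ideal.ramificationIdxIn q.asIdeal (𝓞 L) * Ideal.inertiaDegIn q.asIdeal (𝓞 L) = 1 := by
          rcases Nat.lt_or_ge 1 (Ideal.ramificationIdxIn q.asIdeal (𝓞 L) *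
            Ideal.inertiaDegIn q.asIdeal (𝓞 L)) with h | h
          · nlinarith
          · rcases Nat.le_one_iff_eq_zero_or_eq_one.1 h with h | h
            · rw [h] at hid; omega
            · exact h
        exact Nat.eq_one_of_mul_eq_one_left h0
      have hnorm : ∀ (P : Ideal (𝓞 L)) [P.IsPrime] [P.LiesOver q.asIdeal],
          Ideal.absNorm P = Ideal.absNorm q.asIdeal := by
        intro P _ _
        rw [← Ideal.absNorm_pow_inertiaDeg q.asIdeal P,
          ← Ideal.inertiaDegIn_eq_inertiaDeg q.asIdeal P Gal(L/E), hf, pow_one]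
      exact ⟨⟨Q, hQp, hQ0⟩, ⟨σ • Q, hRp, hR0⟩, hQl, hRl,
        fun h => hσ (congrArg HeightOneSpectrum.asIdeal h).symm, hnorm Q, hnorm (σ • Q)⟩
    choose Q₁ Q₂ l1 l2 hne n1 n2 using hex
    refine infinite_of_pairs E L S ⟨Sum.elim Q₁ Q₂, ?_⟩ n1 n2
    have under : ∀ (q q' : (Sᶜ : Set (HeightOneSpectrum (𝓞 E)))) (Q : HeightOneSpectrum (𝓞 L)),
      Q.asIdeal.LiesOver q.1.asIdeal → Q.asIdeal.LiesOver q'.1.asIdeal → q = q' := by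
      intro q q' Q h h'
      apply Subtype.ext
      apply HeightOneSpectrum.ext
      rw [h.over, h'.over]
    rintro (v | v) (w | w) hvw
    · simp only [Sum.elim_inl] at hvw
      rw [under v w (Q₁ v) (l1 v) (hvw ▸ l1 w)]
    · simp only [Sum.elim_inl, Sum.elim_inr] at hvw
      obtain rfl := under v w (Q₁ v) (l1 v) (hvw ▸ l2 w)
      exact absurd hvw (hne v)
    · simp only [Sum.elim_inl, Sum.elim_inr] at hvw
      obtain rfl := under v w (Q₂ v) (l2 v) (hvw ▸ l1 w)
      exact absurd hvw.symm (hne v)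
    · simp only [Sum.elim_inr] at hvw
      rw [under v w (Q₂ v) (l2 v) (hvw ▸ l2 w)]
  by_contra hcon
  push Not at hcon
  apply hS
  have hfin : {Q : HeightOneSpectrum (𝓞 L) | Q.asIdeal ∣ Ideal.span {a}}.Finite :=
    Ideal.finite_factors (by simpa using ha)
  have hnonempty : Nonempty (HeightOneSpectrum (𝓞 L)) := by
    obtain ⟨q, Q, _⟩ := hS.nonempty
    exact ⟨Q⟩
  choose! g hg1 hg2 using fun (q : HeightOneSpectrum (𝓞 E)) (hq : q ∈ S) => hq
  refine Set.Finite.of_finite_image (f := g) (hfin.subset ?_) ?_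
  · rintro _ ⟨q, hq, rfl⟩
    by_contra h
    obtain ⟨σ, hσ⟩ := hcon (g q) (fun hmem => h (by
      simpa [Ideal.dvd_iff_le, Ideal.span_singleton_le_iff_mem] using hmem))
    exact hσ (hg2 q hq σ)
  · intro q hq q' hq' heq
    apply HeightOneSpectrum.ext
    rw [(hg1 q hq).over, (hg1 q' hq').over, heq]


lemma perm4_aux1 : ∀ (g h : Equiv.Perm (Fin 4)) (i : Fin 4), g i = i → g * g ≠ 1 → h i ≠ i →
    (∀ j, (g * (h * g * h⁻¹)) j ≠ j) ∨ (∀ j, (g⁻¹ * (h * g * h⁻¹)) j ≠ j) := by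
  decide +kernel

set_option synthInstance.maxSize 1000 in
set_option synthInstance.maxHeartbeats 200000 in
lemma perm4_aux2 : ∀ (g h : Equiv.Perm (Fin 4)) (i : Fin 4), g 0 ≠ 0 → g * g = 1 → g i = i →
    h i ≠ i → (∀ j, h j ≠ j) ∨ h * h ≠ 1 ∨ (∀ j, (g * h) j ≠ j) ∨ (g * h) * (g * h) ≠ 1 := by
  decide +kernel

lemma perm4_aux3 : ∀ (g : Equiv.Perm (Fin 4)), (∀ j, g j ≠ j) →
    g * g = 1 ∨ ((∀ j, (g * g) j ≠ j) ∧ (g * g) * (g * g) = 1) := by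
  decide +kernel

lemma perm4 (G : Subgroup (Equiv.Perm (Fin 4))) (hG : ∀ i, ∃ g ∈ G, g i ≠ i) :
    ∃ g ∈ G, (∀ i, g i ≠ i) ∧ g * g = 1 := by
  have fin : (∃ g ∈ G, ∀ i, g i ≠ i) → ∃ g ∈ G, (∀ i, g i ≠ i) ∧ g * g = 1 := by
    rintro ⟨g, hg, h⟩
    rcases perm4_aux3 g h with h1 | ⟨h1, h2⟩
    · exact ⟨g, hg, h, h1⟩
    · exact ⟨g * g, G.mul_mem hg hg, h1, h2⟩
  apply fin
  have T : ∀ k ∈ G, k * k ≠ 1 → ∃ g ∈ G, ∀ i, g i ≠ i := by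
    intro k hk hkk
    by_cases hf : ∀ i, k i ≠ i
    · exact ⟨k, hk, hf⟩
    · push Not at hf
      obtain ⟨i, hi⟩ := hf
      obtain ⟨h, hh, hhi⟩ := hG i
      have hc : h * k * h⁻¹ ∈ G := G.mul_mem (G.mul_mem hh hk) (G.inv_mem hh)
      rcases perm4_aux1 k h i hi hkk hhi with h1 | h1
      · exact ⟨_, G.mul_mem hk hc, h1⟩
      · exact ⟨_, G.mul_mem (G.inv_mem hk) hc, h1⟩
  obtain ⟨g, hg, hg0⟩ := hG 0
  by_cases hgg : g * g = 1
  · by_cases hf : ∀ i, g i ≠ i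
    · exact ⟨g, hg, hf⟩
    · push Not at hf
      obtain ⟨i, hi⟩ := hf
      obtain ⟨h, hh, hhi⟩ := hG i
      rcases perm4_aux2 g h i hg0 hgg hi hhi with h1 | h1 | h1 | h1
      · exact ⟨h, hh, h1⟩
      · exact T h hh h1
      · exact ⟨_, G.mul_mem hg hh, h1⟩
      · exact T _ (G.mul_mem hg hh) h1
  · exact T g hg hgg

/-- A separable quartic without roots: there is a fixed-point-free involution in the Galois group. -/
lemma exists_invol (F : Type*) [Field F] [CharZero F] (P : F[X]) (hdeg : P.natDegree = 4)
    (hsep : P.Separable) (hnoroot : ∀ x : F, P.eval x ≠ 0) :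
    ∃ σ : Gal(P.SplittingField/F), σ * σ = 1 ∧ ∀ t : P.SplittingField, aeval t P = 0 → σ t ≠ t := by
  classical
  have hP0 : P ≠ 0 := by rintro rfl; simp at hdeg
  have hgal : IsGalois F P.SplittingField := IsGalois.of_separable_splitting_field hsep
  have hcard : Fintype.card (P.rootSet P.SplittingField) = 4 := by
    rw [Polynomial.card_rootSet_eq_natDegree hsep (SplittingField.splits P), hdeg]
  let e : P.rootSet P.SplittingField ≃ Fin 4 := Fintype.equivFinOfCardEq hcard
  let φ : Gal(P.SplittingField/F) →* Equiv.Perm (Fin 4) :=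
    (e.permCongrHom.toMonoidHom).comp (@MulAction.toPermHom P.Gal (P.rootSet P.SplittingField) _
      (Polynomial.Gal.galActionAux P))
  have hφ : ∀ σ (t : P.rootSet P.SplittingField), ((e.symm (φ σ (e t))) : P.SplittingField) = σ t := by
    intro σ t
    change ((e.symm (e ((@MulAction.toPermHom P.Gal (P.rootSet P.SplittingField) _
      (Polynomial.Gal.galActionAux P)) σ (e.symm (e t))))) : P.SplittingField) = σ t
    rw [e.symm_apply_apply, e.symm_apply_apply]
    rfl
  obtain ⟨_, ⟨σ, rfl⟩, h1, h2⟩ := perm4 φ.range (by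
    intro i
    by_contra hcon
    push Not at hcon
    set t := e.symm i with ht
    have hfix : ∀ σ : Gal(P.SplittingField/F), σ (t : P.SplittingField) = t := by
      intro σ
      rw [← hφ, ht]
      simp [hcon (φ σ) ⟨σ, rfl⟩]
    obtain ⟨x, hx⟩ := (IsGalois.mem_bot_iff_fixed (t : P.SplittingField)).2 hfix
    have ht0 := (mem_rootSet.1 t.2).2
    have hx' : algebraMap F P.SplittingField x = t := hx
    rw [← hx', aeval_algebraMap_apply, map_eq_zero] at ht0
    exact hnoroot x (by simpa [aeval_def] using ht0))
  have hσ : ∀ t : P.SplittingField, aeval t P = 0 → σ t ≠ t := by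
    intro t ht hcon
    let t' : P.rootSet P.SplittingField := ⟨t, mem_rootSet.2 ⟨hP0, ht⟩⟩
    apply h1 (e t')
    apply e.symm.injective
    apply Subtype.ext
    rw [hφ]
    simpa [t'] using hcon
  refine ⟨σ, ?_, hσ⟩
  apply Polynomial.Gal.ext
  intro t ht
  have a1 := hφ (σ * σ) ⟨t, ht⟩
  rw [map_mul, h2] at a1
  change σ (σ t) = t
  simpa using a1.symm


open Pointwise in
/-- Valuations at a prime stable under `σ` are invariant under `σ`. -/
lemma valuation_invariant (E L : Type*) [Field E] [NumberField E] [Field L] [NumberField L]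
    [Algebra E L] [IsGalois E L] (Q : HeightOneSpectrum (𝓞 L)) (σ : Gal(L/E))
    (h : σ • Q.asIdeal = Q.asIdeal) (x : L) :
    Q.valuation L (σ x) = Q.valuation L x := by
  have hpow : ∀ n : ℕ, σ • (Q.asIdeal ^ n) = Q.asIdeal ^ n := by
    intro n; rw [smul_pow', h]
  have hint : ∀ r : 𝓞 L, Q.intValuation (σ • r) = Q.intValuation r := by
    intro r
    by_cases hr : r = 0
    · simp [hr]
    have hr' : σ • r ≠ 0 := by rwa [smul_ne_zero_iff_ne]
    rw [Q.intValuation_eq_exp_neg_multiplicity hr, Q.intValuation_eq_exp_neg_multiplicity hr']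
    have : multiplicity Q.asIdeal (Ideal.span {σ • r}) = multiplicity Q.asIdeal (Ideal.span {r}) := by
      apply multiplicity_eq_of_emultiplicity_eq
      rw [emultiplicity_eq_emultiplicity_iff]
      intro n
      rw [Ideal.dvd_span_singleton, Ideal.dvd_span_singleton]
      nth_rewrite 1 [← hpow n]
      exact Ideal.smul_mem_pointwise_smul_iff
    rw [this]
  obtain ⟨a, b, hb, rfl⟩ := IsFractionRing.div_surjective (A := 𝓞 L) x
  have hc : ∀ r : 𝓞 L, σ (algebraMap (𝓞 L) L r) = algebraMap (𝓞 L) L (σ • r) := fun r => rfl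
  rw [map_div₀, map_div₀, map_div₀, hc, hc]
  simp only [HeightOneSpectrum.valuation_of_algebraMap, hint]

lemma exists_stable (F L : Type*) [Field F] [NumberField F] [Field L] [NumberField L]
    [Algebra F L] [IsGalois F L] (σ : Gal(L/F)) (h1 : σ * σ = 1) (h2 : σ ≠ 1) (a : 𝓞 L) (ha : a ≠ 0) :
    ∃ Q : HeightOneSpectrum (𝓞 L), a ∉ Q.asIdeal ∧
      ∀ x : L, Q.valuation L (σ x) = Q.valuation L x := by
  let E := IntermediateField.fixedField (Subgroup.zpowers σ)
  have hord : orderOf σ = 2 := orderOf_eq_prime (by rw [sq, h1]) h2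
  have hfr : Module.finrank E L = 2 := by
    rw [IntermediateField.finrank_fixedField_eq_card, Nat.card_zpowers, hord]
  have : NumberField E := NumberField.of_intermediateField E
  have : IsGalois E L := inferInstance
  obtain ⟨Q, hQ, hst⟩ := exists_nonsplit E L hfr a ha
  let σ' : Gal(L/E) := AlgEquiv.ofRingEquiv (f := σ.toRingEquiv) (fun x =>
    (IntermediateField.mem_fixedField_iff _ _).1 x.2 σ (Subgroup.mem_zpowers σ))
  exact ⟨Q, hQ, fun x => valuation_invariant E L Q σ' (hst σ') x⟩

lemma exists_good (L : Type*) [Field L] [NumberField L] (X : Finset L) (hX : ∀ x ∈ X, x ≠ 0) :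
    ∃ a : 𝓞 L, a ≠ 0 ∧ ∀ Q : HeightOneSpectrum (𝓞 L), a ∉ Q.asIdeal →
      ∀ x ∈ X, Q.valuation L x = 1 := by
  classical
  induction X using Finset.induction_on with
  | empty => exact ⟨1, one_ne_zero, by simp⟩
  | insert x X hx ih =>
    obtain ⟨a, ha, h⟩ := ih (fun y hy => hX y (Finset.mem_insert_of_mem hy))
    have hx0 := hX x (Finset.mem_insert_self _ _)
    obtain ⟨m, n, hn, rfl⟩ := IsFractionRing.div_surjective (A := 𝓞 L) x
    have hn0 : n ≠ 0 := nonZeroDivisors.ne_zero hn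
    have hm0 : m ≠ 0 := by rintro rfl; simp at hx0
    refine ⟨a * (m * n), mul_ne_zero ha (mul_ne_zero hm0 hn0), fun Q hQ y hy => ?_⟩
    have hQa : a ∉ Q.asIdeal := fun hh => hQ (Q.asIdeal.mul_mem_right _ hh)
    have hQm : m ∉ Q.asIdeal := fun hh => hQ (Q.asIdeal.mul_mem_left _ (Q.asIdeal.mul_mem_right _ hh))
    have hQn : n ∉ Q.asIdeal := fun hh => hQ (Q.asIdeal.mul_mem_left _ (Q.asIdeal.mul_mem_left _ hh))
    rcases Finset.mem_insert.1 hy with rfl | hy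
    · rw [map_div₀, Q.valuation_eq_one_iff_notMem.2 hQm, Q.valuation_eq_one_iff_notMem.2 hQn, div_one]
    · exact h Q hQa y hy

lemma valuation_eval {L : Type*} [Field L] {Γ : Type*} [LinearOrderedCommGroupWithZero Γ]
    (v : Valuation L Γ) (σ : L →+* L) (hσ : ∀ x, v (σ x) = v x) (P : L[X]) (hP : P.Splits)
    (hdeg : P.natDegree = 4) (hlc : v P.leadingCoeff = 1) (hr : ∀ α ∈ P.roots, v α ≤ 1)
    (hs : ∀ α ∈ P.roots, v (α - σ α) = 1) (u : L) (hu : σ u = u) :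
    v (P.eval u) = (max 1 (v u)) ^ 4 := by
  rw [hP.eval_eq_prod_roots, map_mul, hlc, one_mul, map_multiset_prod, Multiset.map_map]
  have key : ∀ α ∈ P.roots, v (u - α) = max 1 (v u) := by
    intro α hα
    rcases lt_or_ge 1 (v u) with h | h
    · rw [max_eq_right h.le, Valuation.map_sub_eq_of_lt_left _ ((hr α hα).trans_lt h)]
    · rw [max_eq_left h]
      have h1 : v (u - α) ≤ 1 := (v.map_sub u α).trans (max_le h (hr α hα))
      refine le_antisymm h1 ?_
      have h2 : v (u - σ α) = v (u - α) := by
        have h4 : σ (u - α) = u - σ α := by rw [map_sub, hu]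
        rw [← hσ (u - α), h4]
      have h3 : α - σ α = (u - σ α) - (u - α) := by ring
      rw [← hs α hα, h3]
      refine (v.map_sub _ _).trans ?_
      rw [h2, max_self]
  rw [Multiset.map_congr rfl (g := fun _ => max 1 (v u)) (by intro α hα; exact key α hα)]
  rw [Multiset.map_const', Multiset.prod_replicate, ← hP.natDegree_eq_card_roots, hdeg]

/-- Degree 4, `n = 2` case: a separable quartic `P ∈ O_F[T]` with no root in `F` has a Galois
element fixing no root; consequently some quadratic twist `Y² = d·P(T,Z)` (with `d` a
non-square) has no `F`-rational point. -/
theorem stmt16 (F : Type*) [Field F] [NumberField F] (p : Polynomial (𝓞 F))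
    (hdeg : p.natDegree = 4)
    (hsep : (p.map (algebraMap (𝓞 F) F)).Separable)
    (hnoroot : ∀ x : F, (p.map (algebraMap (𝓞 F) F)).eval x ≠ 0) :
    (∃ σ : (p.map (algebraMap (𝓞 F) F)).SplittingField ≃ₐ[F]
        (p.map (algebraMap (𝓞 F) F)).SplittingField,
      ∀ t : (p.map (algebraMap (𝓞 F) F)).SplittingField,
        aeval t (p.map (algebraMap (𝓞 F) F)) = 0 → σ t ≠ t) ∧
    ∃ d : 𝓞 F, d ≠ 0 ∧ (¬ ∃ c : 𝓞 F, c ^ 2 = d) ∧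
      ¬ ∃ y t z : F, (y, t, z) ≠ (0, 0, 0) ∧
        y ^ 2 = (algebraMap (𝓞 F) F d) *
          ∑ i ∈ Finset.range 5, (algebraMap (𝓞 F) F (p.coeff i)) * t ^ i * z ^ (4 - i) := by
  classical
  set P := p.map (algebraMap (𝓞 F) F) with hP
  have hPdeg : P.natDegree = 4 := by
    rw [hP, natDegree_map_eq_of_injective (FaithfulSMul.algebraMap_injective (𝓞 F) F), hdeg]
  have hP0 : P ≠ 0 := by intro h; rw [h] at hPdeg; simp at hPdeg
  obtain ⟨σ, hσσ, hσ⟩ := exists_invol F P hPdeg hsep hnoroot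
  refine ⟨⟨σ, hσ⟩, ?_⟩
  have hNF : NumberField P.SplittingField := NumberField.of_module_finite F P.SplittingField
  set L := P.SplittingField with hL
  set R := P.map (algebraMap F L) with hR
  have hRs : R.Splits := SplittingField.splits P
  have hRdeg : R.natDegree = 4 := by rw [hR, natDegree_map, hPdeg]
  have hR0 : R ≠ 0 := by intro h; rw [h] at hRdeg; simp at hRdeg
  have hroot : ∀ α ∈ R.roots, σ α ≠ α := by
    intro α hα
    apply hσ
    have := (mem_roots hR0).1 hα
    rwa [IsRoot, hR, eval_map_algebraMap] at this
  have hσ1 : σ ≠ 1 := by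
    rintro rfl
    have hc : R.roots.card = 4 := by rw [← hRs.natDegree_eq_card_roots, hRdeg]
    obtain ⟨α, hα⟩ := Multiset.card_pos_iff_exists_mem.1 (by rw [hc]; norm_num : 0 < R.roots.card)
    exact hroot α hα rfl
  obtain ⟨a, ha, hgood⟩ := exists_good L
    (insert R.leadingCoeff (R.roots.toFinset.image (fun α => α - σ α) ∪
      (R.roots.toFinset.filter (fun α => α ≠ 0)))) (by
    intro x hx
    simp only [Finset.mem_insert, Finset.mem_union, Finset.mem_image, Finset.mem_filter,
      Multiset.mem_toFinset] at hx
    rcases hx with rfl | ⟨α, hα, rfl⟩ | ⟨_, hx⟩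
    · exact leadingCoeff_ne_zero.2 hR0
    · exact sub_ne_zero.2 (hroot α hα).symm
    · exact hx)
  have hGal : IsGalois F L := IsGalois.of_separable_splitting_field (p := P) hsep
  obtain ⟨Q, hQa, hQσ⟩ := exists_stable F L σ hσσ hσ1 a ha
  have hg := hgood Q hQa
  have hmain := valuation_eval (Q.valuation L) (σ : L →+* L) hQσ R hRs hRdeg
    (hg _ (by simp)) (by
      intro α hα
      by_cases h0 : α = 0
      · simp [h0]
      · refine (hg α ?_).le
        simp only [Finset.mem_insert, Finset.mem_union, Finset.mem_filter, Multiset.mem_toFinset]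
        exact Or.inr (Or.inr ⟨hα, h0⟩))
    (by
      intro α hα
      refine hg _ ?_
      simp only [Finset.mem_insert, Finset.mem_union, Finset.mem_image, Multiset.mem_toFinset]
      exact Or.inr (Or.inl ⟨α, hα, rfl⟩))
  have hQp := Q.isPrime
  let 𝔭 : HeightOneSpectrum (𝓞 F) := ⟨Q.asIdeal.under (𝓞 F), inferInstance,
    Ideal.IsIntegral.comap_ne_bot _ Q.ne_bot⟩
  have hlies : Q.asIdeal.LiesOver 𝔭.asIdeal := ⟨rfl⟩
  set v := 𝔭.valuation F with hv
  set e := 𝔭.asIdeal.ramificationIdx' Q.asIdeal with he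
  have he0 : e ≠ 0 := Ideal.IsDedekindDomain.ramificationIdx'_ne_zero_of_liesOver Q.asIdeal 𝔭.ne_bot
  have hval : ∀ x : F, v x ^ e = Q.valuation L (algebraMap F L x) :=
    fun x => HeightOneSpectrum.valuation_liesOver L 𝔭 Q x
  have hvu : ∀ u : F, v (P.eval u) = (max 1 (v u)) ^ 4 := by
    intro u
    have h1 := hmain (algebraMap F L u) (σ.commutes u)
    rw [hR, eval_map_algebraMap, aeval_algebraMap_apply, ← hval, ← hval] at h1
    have h2 : (max 1 (v u ^ e)) = (max 1 (v u)) ^ e := by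
      rcases le_total 1 (v u) with h | h
      · rw [max_eq_right h, max_eq_right (one_le_pow₀ h)]
      · rw [max_eq_left h, max_eq_left (pow_le_one' h e), one_pow]
    rw [h2, ← pow_mul, mul_comm e 4, pow_mul] at h1
    exact (pow_left_inj₀ (by simp) (by simp) he0).1 h1
  have hlc : v P.leadingCoeff = 1 := by
    have h1 : Q.valuation L R.leadingCoeff = 1 := hg _ (by simp)
    rw [hR, leadingCoeff_map, ← hval] at h1
    exact (pow_left_inj₀ (by simp) (by simp) he0).1 (h1.trans (one_pow e).symm)
  obtain ⟨d, hd⟩ := 𝔭.intValuation_exists_uniformizer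
  have hvd : v (algebraMap (𝓞 F) F d) = WithZero.exp (-1) := by
    rw [hv, HeightOneSpectrum.valuation_of_algebraMap, hd]
  have hsq : ∀ (y : F) (m : F), m ≠ 0 → v y ^ 2 ≠ WithZero.exp (-1 : ℤ) * v m ^ 4 := by
    intro y m hm h
    have hm' : v m ≠ 0 := by rwa [Ne, map_eq_zero]
    have := congrArg WithZero.log h
    rw [WithZero.log_mul (by simp) (pow_ne_zero _ hm'), WithZero.log_pow, WithZero.log_pow,
      WithZero.log_exp] at this
    simp only [nsmul_eq_mul] at this
    push_cast at this
    omega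
  refine ⟨d, ?_, ?_, ?_⟩
  · rintro rfl
    rw [map_zero] at hd
    exact WithZero.exp_ne_zero hd.symm
  · rintro ⟨c, rfl⟩
    apply hsq (algebraMap (𝓞 F) F c) 1 one_ne_zero
    rw [← map_pow, ← map_pow, hvd]
    simp
  · rintro ⟨y, t, z, hne, heq⟩
    have hcoef : ∀ i, algebraMap (𝓞 F) F (p.coeff i) = P.coeff i := fun i => by rw [hP, coeff_map]
    simp only [hcoef] at heq
    have hex : ∃ m : F, m ≠ 0 ∧
        v (∑ i ∈ Finset.range 5, P.coeff i * t ^ i * z ^ (4 - i)) = v m ^ 4 := by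
      by_cases hz : z = 0
      · subst hz
        have hsum : ∑ i ∈ Finset.range 5, P.coeff i * t ^ i * (0:F) ^ (4 - i) =
            P.leadingCoeff * t ^ 4 := by
          simp [Finset.sum_range_succ, leadingCoeff, hPdeg]
        refine ⟨t, ?_, ?_⟩
        · rintro rfl
          rw [hsum] at heq
          simp at heq
          exact hne (by simp [heq])
        · rw [hsum, map_mul, hlc, one_mul, map_pow]
      · have hsum : ∑ i ∈ Finset.range 5, P.coeff i * t ^ i * z ^ (4 - i) =
            z ^ 4 * P.eval (t / z) := by
          rw [eval_eq_sum_range' (n := 5) (by omega)]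
          simp only [Finset.sum_range_succ, Finset.sum_range_zero]
          norm_num
          field_simp
        rw [hsum, map_mul, map_pow, hvu]
        rcases le_total 1 (v (t / z)) with h | h
        · have ht : t ≠ 0 := by
            rintro rfl
            simp at h
          refine ⟨t, ht, ?_⟩
          rw [max_eq_right h, ← mul_pow, ← map_mul, mul_div_cancel₀ _ hz]
        · exact ⟨z, hz, by rw [max_eq_left h, one_pow, mul_one]⟩
    obtain ⟨m, hm, hvm⟩ := hex
    apply hsq y m hm
    rw [← hvm, ← hvd, ← map_mul, ← heq, map_pow]
end
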